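/- arXiv:0907.5232 — 5 statements merged into one kernel-verified Lean document; each statement's English description precedes it below -/
import Mathlib

section
/- For every positive integer n, there exists a real number N such that for all real x ≥ N, the number of primes p with x/2 < p ≤ x is at least n. Equivalently, π(x) − π(x/2) tends to infinity as x → ∞. -/
/-- `piR x` is the prime-counting function at a real argument: the number of primes `≤ ⌊x⌋`. -/
noncomputable def piR (x : ℝ) : ℕ := Nat.primeCounting ⌊x⌋₊

open Finset in
/-- An upper bound for the central binomial coefficient in terms of the number of primes in
`(n, 2 * n]`. -/
theorem centralBinom_le_mul_pow_primeCounting_sub (n : ℕ) (hn : 2 < n) :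
    n.centralBinom ≤ (2 * n) ^ Nat.sqrt (2 * n) * 4 ^ (2 * n / 3) *
      (2 * n) ^ (Nat.primeCounting (2 * n) - Nat.primeCounting n) := by
  have hpos : 1 ≤ 2 * n := by lia
  have hprod : n.centralBinom =
      ∏ p ∈ Nat.primesLE (2 * n), p ^ n.centralBinom.factorization p := by
    rw [Nat.primesLE_eq_filter_range, prod_filter_of_ne, n.prod_pow_factorization_centralBinom]
    intro p _ h
    contrapose! h
    rw [Nat.factorization_eq_zero_of_not_prime _ h, pow_zero]
  have hle : ∀ p ∈ Nat.primesLE (2 * n), p ^ n.centralBinom.factorization p ≤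
      (if p ≤ Nat.sqrt (2 * n) then 2 * n else 1) * (if p ≤ 2 * n / 3 then p else 1) *
        (if n < p then 2 * n else 1) := by
    intro p hp
    have hprime := Nat.prime_of_mem_primesLE hp
    have hfac : p ^ n.centralBinom.factorization p ≤ 2 * n :=
      Nat.pow_factorization_choose_le hpos
    have hone := hprime.one_lt.le
    have h₂ : 1 ≤ if p ≤ 2 * n / 3 then p else 1 := by split_ifs <;> lia
    have h₃ : 1 ≤ if n < p then 2 * n else 1 := by split_ifs <;> lia
    by_cases hs : p ≤ Nat.sqrt (2 * n)
    · rw [if_pos hs]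
      exact hfac.trans ((Nat.le_mul_of_pos_right _ h₂).trans (Nat.le_mul_of_pos_right _ h₃))
    rw [if_neg hs, one_mul]
    by_cases ht : p ≤ 2 * n / 3
    · rw [if_pos ht]
      refine le_trans ?_ (Nat.le_mul_of_pos_right _ h₃)
      refine (pow_right_mono₀ hone ?_).trans (pow_one p).le
      exact Nat.factorization_choose_le_one (Nat.sqrt_lt'.mp (not_le.1 hs))
    rw [if_neg ht, one_mul]
    by_cases hl : n < p
    · rwa [if_pos hl]
    · rw [Nat.factorization_centralBinom_of_two_mul_self_lt_three_mul hn (by lia) (by lia),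
        pow_zero]
      exact h₃
  rw [hprod]
  refine (prod_le_prod' hle).trans ?_
  rw [prod_mul_distrib, prod_mul_distrib, ← prod_filter, ← prod_filter, ← prod_filter,
    prod_const, prod_const]
  gcongr ?_ * ?_ * ?_
  · refine pow_right_mono₀ hpos ?_
    calc _ ≤ (Icc 1 (Nat.sqrt (2 * n))).card := card_le_card fun p hp ↦ by
          obtain ⟨h₁, h₂⟩ := mem_filter.1 hp
          exact mem_Icc.2 ⟨(Nat.prime_of_mem_primesLE h₁).one_lt.le, h₂⟩
      _ = _ := by simp
  · refine le_trans (prod_le_prod_of_subset_of_one_le' ?_ ?_) (primorial_le_four_pow (2 * n / 3))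
    · intro p hp
      obtain ⟨h₁, h₂⟩ := mem_filter.1 hp
      exact mem_filter.2 ⟨mem_range.2 (by lia), Nat.prime_of_mem_primesLE h₁⟩
    · exact fun p hp _ ↦ (mem_filter.1 hp).2.one_lt.le
  · refine pow_right_mono₀ hpos ?_
    have hsub : Nat.primesLE n ⊆ Nat.primesLE (2 * n) := by
      intro p hp
      simp only [Nat.mem_primesLE] at hp ⊢
      exact ⟨by lia, hp.2⟩
    rw [← Nat.primesLE_card_eq_primeCounting, ← Nat.primesLE_card_eq_primeCounting,
      ← card_sdiff_of_subset hsub]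
    refine card_le_card fun p hp ↦ ?_
    obtain ⟨h₁, h₂⟩ := mem_filter.1 hp
    refine mem_sdiff.2 ⟨h₁, fun h ↦ ?_⟩
    have := (Nat.mem_primesLE.1 h).1
    lia

open Filter Real in
/-- A strengthening of `bertrand_main_inequality` with an additional fixed power of `2 * n`,
valid for all large `n`. -/
theorem eventually_mul_pow_sqrt_mul_four_pow_mul_pow_le (k : ℕ) :
    ∀ᶠ n : ℕ in atTop,
      n * ((2 * n) ^ Nat.sqrt (2 * n) * 4 ^ (2 * n / 3) * (2 * n) ^ k) ≤ 4 ^ n := by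
  have hlog4 : 0 < log 4 := log_pos (by norm_num)
  have hreal : ∀ᶠ y : ℝ in atTop, log y ≤ log 4 / 12 * √y ∧ (1 + k : ℝ) ≤ √y := by
    have h := (isLittleO_log_rpow_atTop (r := 1 / 2) (by norm_num)).bound
      (show 0 < log 4 / 12 by positivity)
    filter_upwards [h, tendsto_sqrt_atTop.eventually_ge_atTop (1 + k : ℝ)] with y hy hy'
    refine ⟨?_, hy'⟩
    rw [← sqrt_eq_rpow, norm_of_nonneg (sqrt_nonneg y)] at hy
    exact (le_abs_self _).trans hy
  have htend : Tendsto (fun n : ℕ ↦ 2 * (n : ℝ)) atTop atTop :=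
    tendsto_natCast_atTop_atTop.const_mul_atTop two_pos
  filter_upwards [htend.eventually hreal, eventually_ge_atTop 1] with n ⟨hlog, hsqrt⟩ hn
  have hn' : (1 : ℝ) ≤ n := by exact_mod_cast hn
  rw [← Nat.cast_le (α := ℝ)]
  push_cast
  rw [← log_le_log_iff (by positivity) (by positivity), log_mul (by positivity) (by positivity),
    log_mul (by positivity) (by positivity), log_mul (by positivity) (by positivity),
    log_pow, log_pow, log_pow, log_pow]
  have h₁ : log n ≤ log (2 * n) := log_le_log (by positivity) (by linarith)
  have h₀ : 0 ≤ log (2 * n : ℝ) := log_nonneg (by linarith)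
  have h₂ : (Nat.sqrt (2 * n) : ℝ) ≤ √(2 * n) := by
    exact_mod_cast nat_sqrt_le_real_sqrt (a := 2 * n)
  have h₃ : ((2 * n / 3 : ℕ) : ℝ) ≤ 2 * n / 3 := by
    exact_mod_cast Nat.cast_div_le (α := ℝ) (m := 2 * n) (n := 3)
  have h₄ : √(2 * n : ℝ) * √(2 * n) = 2 * n := mul_self_sqrt (by positivity)
  calc _ ≤ log (2 * n) + (√(2 * n) * log (2 * n) + 2 * n / 3 * log 4 + k * log (2 * n)) := by
        gcongr
    _ = (1 + k + √(2 * n)) * log (2 * n) + 2 * n / 3 * log 4 := by ring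
    _ ≤ (√(2 * n) + √(2 * n)) * (log 4 / 12 * √(2 * n)) + 2 * n / 3 * log 4 := by
        gcongr
    _ = log 4 / 6 * (√(2 * n) * √(2 * n)) + 2 * n / 3 * log 4 := by ring
    _ = n * log 4 := by rw [h₄]; ring

open Filter in
/-- The number of primes in `(n, 2 * n]` tends to infinity with `n`. -/
theorem tendsto_primeCounting_two_mul_sub_primeCounting :
    Tendsto (fun n : ℕ ↦ Nat.primeCounting (2 * n) - Nat.primeCounting n) atTop atTop := by
  refine tendsto_atTop.2 fun k ↦ ?_
  filter_upwards [eventually_mul_pow_sqrt_mul_four_pow_mul_pow_le k, eventually_ge_atTop 4]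
    with n hn hn4
  by_contra! hlt
  refine (Nat.four_pow_lt_mul_centralBinom n hn4).not_ge (le_trans ?_ hn)
  have h := centralBinom_le_mul_pow_primeCounting_sub n (by lia)
  refine Nat.mul_le_mul_left n (h.trans (Nat.mul_le_mul_left _ ?_))
  exact Nat.pow_le_pow_right (by lia) hlt.le

theorem pi_sub_pi_half_tendsto_atTop :
    ∀ n : ℕ, 0 < n → ∃ N : ℝ, ∀ x : ℝ, N ≤ x → n ≤ piR x - piR (x / 2) := by
  intro n _
  have htend : Filter.Tendsto (fun x : ℝ ↦ ⌊x / 2⌋₊) Filter.atTop Filter.atTop :=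
    tendsto_nat_floor_atTop.comp (Filter.tendsto_id.atTop_div_const two_pos)
  obtain ⟨N, hN⟩ := Filter.eventually_atTop.1
    ((tendsto_primeCounting_two_mul_sub_primeCounting.comp htend).eventually_ge_atTop n)
  refine ⟨max N 0, fun x hx ↦ (hN x ((le_max_left _ _).trans hx)).trans ?_⟩
  have hx0 : 0 ≤ x := (le_max_right _ _).trans hx
  refine Nat.sub_le_sub_right (Nat.monotone_primeCounting (Nat.le_floor ?_)) _
  have := Nat.floor_le (show 0 ≤ x / 2 by positivity)
  push_cast
  linarith
end

section
/- For every positive integer n, the n-th Ramanujan prime R_n is a prime number. -/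
/-- The `n`-th Ramanujan prime: the smallest positive integer `R` such that for every
integer `x ≥ R` we have `π(x) − π(x/2) ≥ n`, where `π` counts primes and `x/2`
is `⌊x/2⌋`. -/
noncomputable def ramanujan (n : ℕ) : ℕ :=
  sInf {R : ℕ | 0 < R ∧ ∀ x : ℕ, R ≤ x → n ≤ x.primeCounting - (x / 2).primeCounting}

/-- A bound on the central binomial coefficient in which the primes in `(m, 2 * m]` are
counted. -/
theorem centralBinom_le_pow_primeCounting_sub {m : ℕ} (hm : 2 < m) :
    m.centralBinom ≤ (2 * m) ^ Nat.sqrt (2 * m) * 4 ^ (2 * m / 3) *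
      (2 * m) ^ ((2 * m).primeCounting - m.primeCounting) := by
  have h2m : 1 ≤ 2 * m := by lia
  set f : ℕ → ℕ := fun p ↦ p ^ m.centralBinom.factorization p with hf
  have hprod : ∏ p ∈ Nat.primesLE (2 * m), f p = m.centralBinom := by
    rw [← Nat.prod_pow_factorization_centralBinom m]
    refine Finset.prod_subset (fun p hp ↦ ?_) fun p hp hp' ↦ ?_
    · rw [Nat.mem_primesLE] at hp
      exact Finset.mem_range.2 (by lia)
    · have hnp : ¬ p.Prime := fun h ↦
        hp' (Nat.mem_primesLE.2 ⟨by have := Finset.mem_range.1 hp; lia, h⟩)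
      simp [hf, Nat.factorization_eq_zero_of_not_prime _ hnp]
  have hle : ∀ p ∈ Nat.primesLE (2 * m), f p ≤
      (if p ≤ Nat.sqrt (2 * m) then 2 * m else 1) * (if p ≤ 2 * m / 3 then p else 1) *
        (if m < p then 2 * m else 1) := by
    intro p hp
    have hpp : p.Prime := (Nat.mem_primesLE.1 hp).2
    have hone : 1 ≤ p := hpp.one_le
    have hb : f p ≤ 2 * m := Nat.pow_factorization_choose_le (by lia)
    have hA : 1 ≤ (if p ≤ Nat.sqrt (2 * m) then 2 * m else 1) := by split_ifs <;> lia
    have hB : 1 ≤ (if p ≤ 2 * m / 3 then p else 1) := by split_ifs <;> lia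
    have hC : 1 ≤ (if m < p then 2 * m else 1) := by split_ifs <;> lia
    by_cases h1 : p ≤ Nat.sqrt (2 * m)
    · rw [if_pos h1, mul_assoc]
      exact hb.trans (Nat.le_mul_of_pos_right _ (Nat.mul_pos hB hC))
    by_cases h3 : m < p
    · rw [if_pos h3]
      exact hb.trans (Nat.le_mul_of_pos_left _ (Nat.mul_pos hA hB))
    by_cases h2 : p ≤ 2 * m / 3
    · rw [if_neg h1, if_pos h2, if_neg h3, one_mul, mul_one]
      have h := Nat.factorization_choose_le_one (k := m) (Nat.sqrt_lt'.1 (not_le.1 h1))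
      exact (Nat.pow_le_pow_right hone h).trans (pow_one p).le
    · have h : m.centralBinom.factorization p = 0 :=
        Nat.factorization_centralBinom_of_two_mul_self_lt_three_mul hm (by lia) (by lia)
      simp only [hf, h, pow_zero]
      exact Nat.mul_pos (Nat.mul_pos hA hB) hC
  rw [← hprod]
  refine (Finset.prod_le_prod' hle).trans ?_
  rw [Finset.prod_mul_distrib, Finset.prod_mul_distrib]
  refine Nat.mul_le_mul (Nat.mul_le_mul ?_ ?_) ?_
  · rw [← Finset.prod_filter, Finset.prod_const]
    refine Nat.pow_le_pow_right h2m ?_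
    calc _ ≤ (Finset.Icc 1 (Nat.sqrt (2 * m))).card := Finset.card_le_card fun p hp ↦ by
          rw [Finset.mem_filter, Nat.mem_primesLE] at hp
          exact Finset.mem_Icc.2 ⟨hp.1.2.one_le, hp.2⟩
      _ = _ := by simp
  · rw [← Finset.prod_filter]
    refine le_trans (le_of_eq ?_) (primorial_le_four_pow (2 * m / 3))
    rw [primorial_eq_prod_primesLE]
    refine Finset.prod_congr ?_ fun _ _ ↦ rfl
    ext p
    simp only [Finset.mem_filter, Nat.mem_primesLE]
    constructor
    · exact fun h ↦ ⟨h.2, h.1.2⟩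
    · exact fun h ↦ ⟨⟨by lia, h.2⟩, h.1⟩
  · rw [← Finset.prod_filter, Finset.prod_const]
    refine le_of_eq (congrArg _ ?_)
    rw [← Nat.primesLE_card_eq_primeCounting, ← Nat.primesLE_card_eq_primeCounting,
      ← Finset.card_sdiff_of_subset fun p hp ↦ ?_]
    · congr 1
      ext p
      simp only [Finset.mem_filter, Finset.mem_sdiff, Nat.mem_primesLE]
      constructor
      · exact fun h ↦ ⟨h.1, fun h' ↦ by lia⟩
      · exact fun h ↦ ⟨h.1, by by_contra h'; exact h.2 ⟨by lia, h.1.2⟩⟩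
    · rw [Nat.mem_primesLE] at hp ⊢
      exact ⟨by lia, hp.2⟩

/-- The number of primes in `(m, 2 * m]` tends to infinity. -/
theorem tendsto_primeCounting_two_mul_sub :
    Filter.Tendsto (fun m : ℕ ↦ (2 * m).primeCounting - m.primeCounting)
      Filter.atTop Filter.atTop := by
  rw [Filter.tendsto_atTop]
  intro n
  have hlog2 : 0 < Real.log 2 := Real.log_pos one_lt_two
  have hc : 0 < Real.log 2 / (3 * (n + 2)) := by positivity
  have hlim : Filter.Tendsto (fun m : ℕ ↦ 2 * (m : ℝ)) Filter.atTop Filter.atTop :=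
    tendsto_natCast_atTop_atTop.const_mul_atTop two_pos
  have hsmall := hlim.eventually
    ((isLittleO_log_rpow_atTop (show (0 : ℝ) < 1 / 2 by norm_num)).bound hc)
  filter_upwards [hsmall, Filter.eventually_ge_atTop 4] with m hlog hm
  by_contra! hk
  have hm' : (4 : ℝ) ≤ m := mod_cast hm
  set y : ℝ := 2 * (m : ℝ) with hy
  have hy1 : 1 ≤ y := by linarith
  have hlogy : 0 ≤ Real.log y := Real.log_nonneg hy1
  rw [← Real.sqrt_eq_rpow, Real.norm_of_nonneg hlogy,
    Real.norm_of_nonneg (Real.sqrt_nonneg y)] at hlog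
  have hnat : 4 ^ m < m * ((2 * m) ^ Nat.sqrt (2 * m) * 4 ^ (2 * m / 3) *
      (2 * m) ^ ((2 * m).primeCounting - m.primeCounting)) :=
    (Nat.four_pow_lt_mul_centralBinom m hm).trans_le
      (Nat.mul_le_mul_left m (centralBinom_le_pow_primeCounting_sub (by lia)))
  have hreal : (4 : ℝ) ^ m < m * (y ^ Nat.sqrt (2 * m) * 4 ^ (2 * m / 3) *
      y ^ ((2 * m).primeCounting - m.primeCounting)) := by
    rw [hy]; exact_mod_cast hnat
  have hm0 : (m : ℝ) ≠ 0 := by positivity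
  have hy0 : y ≠ 0 := by positivity
  have hineq := Real.log_lt_log (by positivity) hreal
  rw [Real.log_mul hm0 (by positivity), Real.log_mul (by positivity) (by positivity),
    Real.log_mul (by positivity) (by positivity), Real.log_pow, Real.log_pow, Real.log_pow,
    Real.log_pow, show (4 : ℝ) = 2 ^ 2 by norm_num, Real.log_pow] at hineq
  have h1 : Real.log m ≤ Real.log y := Real.log_le_log (by positivity) (by linarith)
  have h2 : (Nat.sqrt (2 * m) : ℝ) ≤ √y := by
    simpa [hy] using Real.nat_sqrt_le_real_sqrt (a := 2 * m)
  have h3 : ((2 * m / 3 : ℕ) : ℝ) ≤ y / 3 := by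
    simpa [hy] using Nat.cast_div_le (α := ℝ) (m := 2 * m) (n := 3)
  have h4 : (((2 * m).primeCounting - m.primeCounting : ℕ) : ℝ) ≤ n := mod_cast hk.le
  have h5 : 1 ≤ √y := Real.one_le_sqrt.2 hy1
  have h2' := mul_le_mul_of_nonneg_right h2 hlogy
  have h3' := mul_le_mul_of_nonneg_right h3 hlog2.le
  have h4' := mul_le_mul_of_nonneg_right h4 hlogy
  have h6 : (1 + n + √y) * Real.log y ≤ y * Real.log 2 / 3 := by
    calc (1 + n + √y) * Real.log y
        ≤ ((n + 2) * √y) * (Real.log 2 / (3 * (n + 2)) * √y) := by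
          refine mul_le_mul ?_ hlog hlogy (by positivity)
          nlinarith [(Nat.cast_nonneg n : (0 : ℝ) ≤ n)]
      _ = (√y * √y) * Real.log 2 / 3 := by field_simp
      _ = _ := by rw [Real.mul_self_sqrt (by linarith)]
  push_cast at hineq
  have h7 : (m : ℝ) * (2 * Real.log 2) = y * Real.log 2 := by rw [hy]; ring
  nlinarith

theorem exists_forall_le_primeCounting_sub (n : ℕ) :
    ∃ R : ℕ, 0 < R ∧ ∀ x : ℕ, R ≤ x → n ≤ x.primeCounting - (x / 2).primeCounting := by
  obtain ⟨M, hM⟩ := Filter.eventually_atTop.1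
    (tendsto_primeCounting_two_mul_sub.eventually_ge_atTop n)
  refine ⟨2 * M + 1, by lia, fun x hx ↦ (hM (x / 2) (by lia)).trans ?_⟩
  exact Nat.sub_le_sub_right (Nat.monotone_primeCounting (by lia)) _

theorem ramanujan_prime (n : ℕ) (hn : 0 < n) : Nat.Prime (ramanujan n) := by
  obtain ⟨hpos, hR⟩ : 0 < ramanujan n ∧ ∀ x : ℕ, ramanujan n ≤ x →
      n ≤ x.primeCounting - (x / 2).primeCounting :=
    Nat.sInf_mem (exists_forall_le_primeCounting_sub n)
  obtain ⟨r, hr⟩ : ∃ r, ramanujan n = r + 1 := ⟨ramanujan n - 1, by lia⟩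
  have hlt : r.primeCounting - (r / 2).primeCounting < n := by
    rcases Nat.eq_zero_or_pos r with rfl | hr0
    · simpa using hn
    by_contra! h
    have hmem : ramanujan n ≤ r := Nat.sInf_le ⟨hr0, fun x hx ↦ by
      rcases hx.eq_or_lt with rfl | hx
      · exact h
      · exact hR x (by lia)⟩
    lia
  have hge := hR _ le_rfl
  rw [hr] at hge ⊢
  by_contra hnp
  have hcount : (r + 1).primeCounting = r.primeCounting := by
    simp [Nat.primeCounting, Nat.primeCounting', Nat.count_succ _ (r + 1), hnp]
  have hmono : (r / 2).primeCounting ≤ ((r + 1) / 2).primeCounting :=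
    Nat.monotone_primeCounting (by lia)
  lia
end

section
/- For all real x > 300, π(x) − π(x/2) > (1/log x)·(x/6 − 3√x). -/
open Finset ArithmeticFunction Chebyshev

/-- De Polignac's identity for `log n!`, summed over any range `(0, N]` with `n ≤ N`. -/
theorem log_factorial_eq_sum_vonMangoldt {n N : ℕ} (h : n ≤ N) :
    Real.log (n.factorial : ℝ) = ∑ d ∈ Ioc 0 N, vonMangoldt d * ((n / d : ℕ) : ℝ) := by
  induction n with
  | zero => simp
  | succ n ih =>
    have hdiv : (Ioc 0 N).filter (fun d => d ∣ n + 1) = (n + 1).divisors := by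
      ext d
      simp only [mem_filter, mem_Ioc, Nat.mem_divisors]
      constructor
      · rintro ⟨-, h2⟩
        exact ⟨h2, by omega⟩
      · rintro ⟨h2, -⟩
        exact ⟨⟨Nat.pos_of_dvd_of_pos h2 (by omega), (Nat.le_of_dvd (by omega) h2).trans h⟩, h2⟩
    rw [Nat.factorial_succ, Nat.cast_mul, Real.log_mul (by positivity) (by positivity),
      ih (by omega), ← vonMangoldt_sum, ← hdiv, sum_filter, ← sum_add_distrib]
    refine sum_congr rfl fun d _ => ?_
    rw [Nat.succ_div]
    split_ifs <;> push_cast <;> ring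

theorem psi_natDiv_eq_sum_ite (n : ℕ) {k : ℕ} (hk : 0 < k) :
    psi ((n / k : ℕ) : ℝ) = ∑ d ∈ Ioc 0 n, vonMangoldt d * (if k ≤ n / d then 1 else 0) := by
  simp only [psi, Nat.floor_natCast, mul_ite, mul_one, mul_zero]
  rw [← sum_filter]
  congr 1
  ext d
  simp only [mem_filter, mem_Ioc]
  constructor
  · rintro ⟨h1, h2⟩
    rw [Nat.le_div_iff_mul_le hk] at h2
    exact ⟨⟨h1, by nlinarith⟩, by rw [Nat.le_div_iff_mul_le h1]; linarith⟩
  · rintro ⟨⟨h1, -⟩, h2⟩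
    rw [Nat.le_div_iff_mul_le h1] at h2
    exact ⟨h1, by rw [Nat.le_div_iff_mul_le hk]; linarith⟩

theorem log_factorial_sub_eq_sum (n : ℕ) :
    Real.log (n.factorial : ℝ) - 2 * Real.log ((n / 2).factorial : ℝ) =
      ∑ d ∈ Ioc 0 n, vonMangoldt d * ((n / d % 2 : ℕ) : ℝ) := by
  rw [log_factorial_eq_sum_vonMangoldt le_rfl,
    log_factorial_eq_sum_vonMangoldt (Nat.div_le_self n 2), mul_sum, ← sum_sub_distrib]
  refine sum_congr rfl fun d _ => ?_
  have h : ((n / d : ℕ) : ℝ) = 2 * ((n / d / 2 : ℕ) : ℝ) + ((n / d % 2 : ℕ) : ℝ) := by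
    exact_mod_cast (Nat.div_add_mod (n / d) 2).symm
  rw [Nat.div_right_comm, h]
  ring

theorem psi_sub_psi_half_le_log_factorial (n : ℕ) :
    psi n - psi ((n / 2 : ℕ) : ℝ) ≤
      Real.log (n.factorial : ℝ) - 2 * Real.log ((n / 2).factorial : ℝ) := by
  have h1 := psi_natDiv_eq_sum_ite n one_pos
  rw [Nat.div_one] at h1
  rw [h1, psi_natDiv_eq_sum_ite n two_pos, log_factorial_sub_eq_sum, ← sum_sub_distrib]
  refine sum_le_sum fun d _ => ?_
  rw [← mul_sub]
  refine mul_le_mul_of_nonneg_left ?_ vonMangoldt_nonneg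
  generalize n / d = q
  split_ifs with h1 h2 h2
  · simp
  · obtain rfl : q = 1 := by omega
    simp
  · omega
  · simp

theorem log_factorial_le_psi_sub_psi_half_add_psi_third (n : ℕ) :
    Real.log (n.factorial : ℝ) - 2 * Real.log ((n / 2).factorial : ℝ) ≤
      psi n - psi ((n / 2 : ℕ) : ℝ) + psi ((n / 3 : ℕ) : ℝ) := by
  have h1 := psi_natDiv_eq_sum_ite n one_pos
  rw [Nat.div_one] at h1
  rw [h1, psi_natDiv_eq_sum_ite n two_pos, psi_natDiv_eq_sum_ite n three_pos,
    log_factorial_sub_eq_sum, ← sum_sub_distrib, ← sum_add_distrib]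
  refine sum_le_sum fun d _ => ?_
  rw [← mul_sub, ← mul_add]
  refine mul_le_mul_of_nonneg_left ?_ vonMangoldt_nonneg
  generalize n / d = q
  have hq : ((q % 2 : ℕ) : ℝ) ≤ 1 := by exact_mod_cast Nat.le_of_lt_succ (Nat.mod_lt q two_pos)
  by_cases h3 : 3 ≤ q
  · rw [if_pos (by omega), if_pos (by omega), if_pos h3]
    linarith
  · interval_cases q <;> norm_num

theorem log_factorial_two_mul_sub (m : ℕ) :
    Real.log ((2 * m).factorial : ℝ) - 2 * Real.log (m.factorial : ℝ) =
      Real.log (m.centralBinom : ℝ) := by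
  have h : (2 * m).factorial = m.centralBinom * m.factorial * m.factorial := by
    have := Nat.choose_mul_factorial_mul_factorial (show m ≤ 2 * m by omega)
    rw [show 2 * m - m = m by omega] at this
    exact this.symm
  have hc : (m.centralBinom : ℝ) ≠ 0 := by exact_mod_cast m.centralBinom_ne_zero
  rw [h, Nat.cast_mul, Nat.cast_mul, Real.log_mul (by positivity) (by positivity),
    Real.log_mul hc (by positivity)]
  ring

theorem log_factorial_two_mul_add_one_sub (m : ℕ) :
    Real.log ((2 * m + 1).factorial : ℝ) - 2 * Real.log (m.factorial : ℝ) =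
      Real.log (((2 * m + 1) * m.centralBinom : ℕ) : ℝ) := by
  have hc : (m.centralBinom : ℝ) ≠ 0 := by exact_mod_cast m.centralBinom_ne_zero
  rw [Nat.factorial_succ, Nat.cast_mul, Nat.cast_mul, Real.log_mul (by positivity) (by positivity),
    Real.log_mul (by positivity) hc, ← log_factorial_two_mul_sub]
  ring

theorem log_le_div_of_pow_le {a : ℝ} (ha : 0 < a) {j k : ℕ} (hj : 0 < j)
    (h : a ^ j ≤ 2.718 ^ k) : Real.log a ≤ k / j := by
  have h1 : a ^ j ≤ Real.exp k := by
    refine h.trans ?_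
    rw [← Real.exp_one_pow]
    exact pow_le_pow_left₀ (by norm_num) (by linarith [Real.exp_one_gt_d9]) k
  have h2 := Real.log_le_log (by positivity) h1
  rw [Real.log_exp, Real.log_pow] at h2
  rw [le_div_iff₀ (by exact_mod_cast hj)]
  linarith

theorem log_two_mul_add_one_mul_centralBinom_le (m : ℕ) :
    Real.log (((2 * m + 1) * m.centralBinom : ℕ) : ℝ) ≤ 3 * (2 * m + 1) / 4 := by
  rcases lt_or_ge m 4 with hm | hm
  · interval_cases m
    · norm_num
    · have h := log_le_div_of_pow_le (a := 6) (by norm_num) (j := 4) (k := 9) (by norm_num)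
        (by norm_num)
      norm_num [Nat.centralBinom, Nat.choose] at h ⊢
      linarith
    · have h := log_le_div_of_pow_le (a := 30) (by norm_num) (j := 4) (k := 15) (by norm_num)
        (by norm_num)
      norm_num [Nat.centralBinom, Nat.choose] at h ⊢
      linarith
    · have h := log_le_div_of_pow_le (a := 140) (by norm_num) (j := 4) (k := 21) (by norm_num)
        (by norm_num)
      norm_num [Nat.centralBinom, Nat.choose] at h ⊢
      linarith
  · induction m, hm using Nat.le_induction with
    | base =>
      have h := log_le_div_of_pow_le (a := 630) (by norm_num) (j := 4) (k := 27) (by norm_num)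
        (by norm_num)
      norm_num [Nat.centralBinom, Nat.choose] at h ⊢
      linarith
    | succ m hm ih =>
      have hpos : (0 : ℝ) < ((2 * m + 1) * m.centralBinom : ℕ) := by
        exact_mod_cast Nat.mul_pos (by omega) m.centralBinom_pos
      have hpos' : (0 : ℝ) < ((2 * (m + 1) + 1) * (m + 1).centralBinom : ℕ) := by
        exact_mod_cast Nat.mul_pos (by omega) (m + 1).centralBinom_pos
      have hstep : (((2 * (m + 1) + 1) * (m + 1).centralBinom : ℕ) : ℝ) ≤
          4.4 * (((2 * m + 1) * m.centralBinom : ℕ) : ℝ) := by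
        have h : ((m : ℝ) + 1) * (m + 1).centralBinom = 2 * (2 * m + 1) * m.centralBinom := by
          exact_mod_cast Nat.succ_mul_centralBinom_succ m
        have hm' : (4 : ℝ) ≤ m := by exact_mod_cast hm
        refine le_of_mul_le_mul_left ?_ (show (0 : ℝ) < m + 1 by positivity)
        push_cast at hpos ⊢
        calc ((m : ℝ) + 1) * ((2 * (m + 1) + 1) * (m + 1).centralBinom)
            = (2 * (m + 1) + 1) * (((m : ℝ) + 1) * (m + 1).centralBinom) := by ring
          _ = (4 * m + 6) * ((2 * m + 1) * m.centralBinom) := by rw [h]; ring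
          _ ≤ (4.4 * (m + 1)) * ((2 * m + 1) * m.centralBinom) :=
            mul_le_mul_of_nonneg_right (by linarith) hpos.le
          _ = _ := by ring
      have h1 := Real.log_le_log hpos' hstep
      rw [Real.log_mul (by norm_num) hpos.ne'] at h1
      have h2 := log_le_div_of_pow_le (a := 4.4) (by norm_num) (j := 2) (k := 3) (by norm_num)
        (by norm_num)
      push_cast at h1 h2 ih ⊢
      linarith

theorem log_factorial_sub_le (n : ℕ) :
    Real.log (n.factorial : ℝ) - 2 * Real.log ((n / 2).factorial : ℝ) ≤ 3 * n / 4 := by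
  obtain ⟨m, rfl | rfl⟩ := n.even_or_odd'
  · rw [Nat.mul_div_cancel_left m two_pos, log_factorial_two_mul_sub]
    have h1 : (m.centralBinom : ℝ) ≤ 4 ^ m := by exact_mod_cast m.centralBinom_le_four_pow
    have h2 := Real.log_le_log (by exact_mod_cast m.centralBinom_pos) h1
    rw [Real.log_pow, show (4 : ℝ) = 2 ^ 2 by norm_num, Real.log_pow] at h2
    have h3 := mul_le_mul_of_nonneg_left Real.log_two_lt_d9.le (Nat.cast_nonneg (α := ℝ) m)
    have h4 := Nat.cast_nonneg (α := ℝ) m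
    push_cast at h2 ⊢
    linarith
  · rw [show (2 * m + 1) / 2 = m by omega, log_factorial_two_mul_add_one_sub]
    exact_mod_cast log_two_mul_add_one_mul_centralBinom_le m

theorem mul_log_two_sub_log_lt_log_centralBinom {m : ℕ} (hm : 4 ≤ m) :
    2 * m * Real.log 2 - Real.log m < Real.log m.centralBinom := by
  have h1 : (4 : ℝ) ^ m < m * m.centralBinom := by
    exact_mod_cast Nat.four_pow_lt_mul_centralBinom m hm
  have hc : (m.centralBinom : ℝ) ≠ 0 := by exact_mod_cast m.centralBinom_ne_zero
  have h2 := Real.log_lt_log (by positivity) h1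
  rw [Real.log_mul (by exact_mod_cast (by omega : m ≠ 0)) hc, Real.log_pow,
    show (4 : ℝ) = 2 ^ 2 by norm_num, Real.log_pow] at h2
  push_cast at h2
  linarith

/-- The tangent line at `150` bounds the logarithm, with `150 < 2.718 ^ (5.02)`. -/
theorem log_le_tangent {y : ℝ} (hy : 0 < y) : Real.log y ≤ 5.02 + (y / 150 - 1) := by
  have h1 := Real.log_le_sub_one_of_pos (show 0 < y / 150 by positivity)
  rw [Real.log_div hy.ne' (by norm_num)] at h1
  have h2 := log_le_div_of_pow_le (a := 150) (by norm_num) (j := 50) (k := 251) (by norm_num)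
    (by norm_num)
  norm_num at h1 h2 ⊢
  linarith

theorem lt_log_factorial_sub {n : ℕ} (hn : 300 ≤ n) :
    2 * ((n : ℝ) + 1) / 3 <
      Real.log (n.factorial : ℝ) - 2 * Real.log ((n / 2).factorial : ℝ) := by
  obtain ⟨m, rfl | rfl⟩ := n.even_or_odd'
  all_goals
    have hm : 150 ≤ m := by omega
    have hm' : (150 : ℝ) ≤ m := by exact_mod_cast hm
    have h1 := mul_log_two_sub_log_lt_log_centralBinom (show 4 ≤ m by omega)
    have h2 := mul_le_mul_of_nonneg_left Real.log_two_gt_d9.le (Nat.cast_nonneg (α := ℝ) m)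
    have h3 := log_le_tangent (show (0 : ℝ) < m by linarith)
  · rw [Nat.mul_div_cancel_left m two_pos, log_factorial_two_mul_sub]
    push_cast
    linarith
  · rw [show (2 * m + 1) / 2 = m by omega, log_factorial_two_mul_add_one_sub]
    have hc : (m.centralBinom : ℝ) ≠ 0 := by exact_mod_cast m.centralBinom_ne_zero
    rw [Nat.cast_mul, Real.log_mul (by positivity) hc]
    have h4 : Real.log (2 * m) ≤ Real.log ((2 * m + 1 : ℕ) : ℝ) :=
      Real.log_le_log (by positivity) (by push_cast; linarith)
    rw [Real.log_mul (by norm_num) (by positivity)] at h4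
    have h5 := Real.log_two_gt_d9
    push_cast at h4 ⊢
    linarith

theorem psi_natCast_le (n : ℕ) : psi n ≤ 3 / 2 * n := by
  induction n using Nat.strong_induction_on with
  | _ n ih =>
    rcases Nat.eq_zero_or_pos n with rfl | hn
    · simp [psi_zero]
    · have h1 := ih (n / 2) (Nat.div_lt_self hn one_lt_two)
      have h2 := psi_sub_psi_half_le_log_factorial n
      have h3 := log_factorial_sub_le n
      have h4 : ((n / 2 : ℕ) : ℝ) ≤ n / 2 := by exact_mod_cast Nat.cast_div_le (α := ℝ)
      linarith

theorem psi_le_three_halves_mul {x : ℝ} (hx : 0 ≤ x) : psi x ≤ 3 / 2 * x := by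
  rw [psi_eq_psi_coe_floor]
  exact (psi_natCast_le _).trans (mul_le_mul_of_nonneg_left (Nat.floor_le hx) (by norm_num))

theorem rpow_inv_three_add_rpow_inv_five_le_sqrt {x : ℝ} (hx : 300 ≤ x) :
    x ^ (3 : ℝ)⁻¹ + x ^ (5 : ℝ)⁻¹ ≤ √x := by
  have hx0 : 0 ≤ x := by linarith
  obtain ⟨t, ht0, rfl⟩ : ∃ t : ℝ, 0 ≤ t ∧ t ^ 30 = x :=
    ⟨x ^ ((30 : ℕ) : ℝ)⁻¹, by positivity, Real.rpow_inv_natCast_pow hx0 (by norm_num)⟩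
  have h3 : (t ^ 30) ^ (3 : ℝ)⁻¹ = t ^ 10 := by
    rw [show t ^ 30 = (t ^ 10) ^ 3 by ring]
    exact_mod_cast Real.pow_rpow_inv_natCast (pow_nonneg ht0 10) three_ne_zero
  have h5 : (t ^ 30) ^ (5 : ℝ)⁻¹ = t ^ 6 := by
    rw [show t ^ 30 = (t ^ 6) ^ 5 by ring]
    exact_mod_cast Real.pow_rpow_inv_natCast (pow_nonneg ht0 6) (by norm_num)
  have h2 : √(t ^ 30) = t ^ 15 := by
    rw [show t ^ 30 = (t ^ 15) ^ 2 by ring]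
    exact Real.sqrt_sq (pow_nonneg ht0 15)
  rw [h2, h3, h5]
  have ht1 : 1 ≤ t := by
    by_contra! h
    have := pow_le_one₀ (n := 30) ht0 h.le
    linarith
  have ht5 : 2 ≤ t ^ 5 := by
    by_contra! h
    have := pow_le_pow_left₀ (pow_nonneg ht0 5) h.le 6
    rw [← pow_mul] at this
    norm_num at this
    linarith
  have h6 : t ^ 6 ≤ t ^ 10 := pow_le_pow_right₀ ht1 (by norm_num)
  calc t ^ 10 + t ^ 6 ≤ 2 * t ^ 10 := by linarith
    _ ≤ t ^ 5 * t ^ 10 := mul_le_mul_of_nonneg_right ht5 (by positivity)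
    _ = t ^ 15 := by ring

theorem psi_sub_theta_le_three_mul_sqrt {x : ℝ} (hx : 300 ≤ x) :
    psi x - theta x ≤ 3 * √x := by
  have hx0 : 0 ≤ x := by linarith
  have h := psi_sub_theta_le_psi_add_psi_add_psi x
  have h2 := psi_le_three_halves_mul (Real.rpow_nonneg hx0 (2 : ℝ)⁻¹)
  have h3 := psi_le_three_halves_mul (Real.rpow_nonneg hx0 (3 : ℝ)⁻¹)
  have h5 := psi_le_three_halves_mul (Real.rpow_nonneg hx0 (5 : ℝ)⁻¹)
  have hs : x ^ (2 : ℝ)⁻¹ = √x := by rw [Real.sqrt_eq_rpow, one_div]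
  have := rpow_inv_three_add_rpow_inv_five_le_sqrt hx
  rw [hs] at h2 h
  linarith

theorem sub_lt_theta_sub_theta_half {x : ℝ} (hx : 300 < x) :
    x / 6 - 3 * √x < theta x - theta (x / 2) := by
  have hx0 : 0 ≤ x := by linarith
  have h1 := lt_log_factorial_sub (Nat.le_floor (by exact_mod_cast hx.le) : 300 ≤ ⌊x⌋₊)
  have h2 := log_factorial_le_psi_sub_psi_half_add_psi_third ⌊x⌋₊
  have hhalf : ⌊x / 2⌋₊ = ⌊x⌋₊ / 2 := by exact_mod_cast Nat.floor_div_natCast x 2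
  rw [← hhalf, ← psi_eq_psi_coe_floor, ← psi_eq_psi_coe_floor] at h2
  have h3 := psi_natCast_le (⌊x⌋₊ / 3)
  have h4 : ((⌊x⌋₊ / 3 : ℕ) : ℝ) ≤ ⌊x⌋₊ / 3 := by exact_mod_cast Nat.cast_div_le (α := ℝ)
  have h5 := theta_le_psi (x / 2)
  have h6 := psi_sub_theta_le_three_mul_sqrt hx.le
  have h7 := Nat.lt_floor_add_one x
  have h8 := Nat.floor_le hx0
  rw [← hhalf] at h1
  linarith

theorem theta_sub_theta_le {y x : ℝ} (hyx : y ≤ x) (hx : 1 ≤ x) :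
    theta x - theta y ≤
      ((Nat.primeCounting ⌊x⌋₊ : ℝ) - Nat.primeCounting ⌊y⌋₊) * Real.log x := by
  have hsub : Nat.primesLE ⌊y⌋₊ ⊆ Nat.primesLE ⌊x⌋₊ := Nat.primesLE_mono (Nat.floor_mono hyx)
  rw [theta_eq_sum_primesLE, theta_eq_sum_primesLE, ← sum_sdiff hsub, add_sub_cancel_right,
    ← Nat.primesLE_card_eq_primeCounting, ← Nat.primesLE_card_eq_primeCounting,
    ← Nat.cast_sub (card_le_card hsub), ← card_sdiff_of_subset hsub, ← nsmul_eq_mul]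
  refine sum_le_card_nsmul _ _ _ fun p hp => ?_
  have hp' := Nat.mem_primesLE.mp (mem_sdiff.mp hp).1
  exact Real.log_le_log (by exact_mod_cast hp'.2.pos)
    ((Nat.cast_le.mpr hp'.1).trans (Nat.floor_le (by linarith)))

theorem ramanujan_lower_bound (x : ℝ) (hx : 300 < x) :
    (piR x : ℝ) - piR (x / 2) > (1 / Real.log x) * (x / 6 - 3 * Real.sqrt x) := by
  rw [gt_iff_lt, one_div_mul_eq_div, div_lt_iff₀ (Real.log_pos (by linarith))]
  exact (sub_lt_theta_sub_theta_half hx).trans_le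
    (theta_sub_theta_le (by linarith) (by linarith))
end

section
/- For every integer n ≥ 4 and every real x ≥ 4n·log(4n), one has π(x) − π(x/2) > n. -/
/-- The number of `j` with `m ≤ j < m + 2 ^ d`, `j ≤ a` and `j` coprime to `P`, computed by
bisection. -/
def countCoprime (P a : ℕ) : ℕ → ℕ → ℕ
  | 0, m => if m.gcd P = 1 ∧ m ≤ a then 1 else 0
  | d + 1, m => countCoprime P a d m + countCoprime P a d (m + 2 ^ d)

open Finset in
theorem countCoprime_eq_card (P a d m : ℕ) :
    countCoprime P a d m = #{j ∈ Ico m (m + 2 ^ d) | j.Coprime P ∧ j ≤ a} := by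
  induction d generalizing m with
  | zero =>
    have : Ico m (m + 2 ^ 0) = {m} := by ext; simp
    rw [this, filter_singleton, countCoprime]
    split_ifs <;> simp_all
  | succ d ih =>
    rw [countCoprime, ih, ih, ← card_union_of_disjoint, ← filter_union,
      Ico_union_Ico_eq_Ico (Nat.le_add_right _ _) (Nat.le_add_right _ _), pow_succ]
    · congr 3; ring
    · exact disjoint_filter_filter (Ico_disjoint_Ico_consecutive _ _ _)

open Finset in
theorem Nat.card_Ioc_filter_prime_add (a l : ℕ) (h : l ≤ a) :
    Nat.primeCounting a = Nat.primeCounting l + #{p ∈ Ioc l a | p.Prime} := by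
  rw [← Nat.primesLE_card_eq_primeCounting, ← Nat.primesLE_card_eq_primeCounting,
    Nat.primesLE_eq_filter_Icc_zero, Nat.primesLE_eq_filter_Icc_zero,
    ← card_union_of_disjoint, ← filter_union]
  · congr 2; ext; simp; omega
  · refine disjoint_filter_filter (disjoint_left.2 fun x => ?_)
    simp; omega

theorem countCoprime_add_primeCounting_le {a k l : ℕ} (d : ℕ) (hk : 1 ≤ k) (hkl : k ≤ l)
    (hla : l ≤ a) (ha : a < (k + 1) ^ 2) :
    Nat.primeCounting l + countCoprime k.factorial a d (l + 1) ≤ Nat.primeCounting a := by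
  rw [Nat.card_Ioc_filter_prime_add a l hla, countCoprime_eq_card]
  gcongr
  intro j
  simp only [Finset.mem_filter, Finset.mem_Ico, Finset.mem_Ioc]
  rintro ⟨⟨h1, h2⟩, h3, h4⟩
  refine ⟨⟨by omega, h4⟩, ?_⟩
  by_contra hj
  have := (Nat.coprime_factorial_iff (by omega)).1 h3
  have h5 := Nat.minFac_sq_le_self (by omega) hj
  nlinarith


theorem div_mul_log_two_le_log {p m : ℕ} (h : 2 ^ p ≤ m ^ 8) :
    p / 8 * Real.log 2 ≤ Real.log m := by
  have := Real.log_le_log (by positivity) (show ((2 : ℝ) ^ p) ≤ (m : ℝ) ^ 8 by exact_mod_cast h)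
  rw [Real.log_pow, Real.log_pow] at this
  push_cast at this
  linarith

theorem lt_primeCounting_sub_of_range {n : ℕ} {x : ℝ} {a b : ℕ} (l c k d p : ℕ)
    (h : 1 ≤ k ∧ k ≤ l ∧ l ≤ a ∧ a < (k + 1) ^ 2 ∧ b ≤ 2 * l + 2 ∧ 0 < c ∧
      2 ^ p ≤ (4 * c) ^ 8 ∧ b * 8000000 ≤ 4 * c * p * 693147 ∧
      c ≤ countCoprime k.factorial a d (l + 1))
    (hx : 4 * n * Real.log (4 * n) ≤ x) (ha : a ≤ x) (hb : x < b) :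
    n < piR x - piR (x / 2) := by
  obtain ⟨h1, h2, h3, h4, h5, h6, h7, h8, h9⟩ := h
  have hx0 : 0 ≤ x := a.cast_nonneg.trans ha
  have hnc : n < c := by
    by_contra! hcn
    have hc : (1 : ℝ) ≤ c := by exact_mod_cast h6
    have hcn' : (c : ℝ) ≤ n := by exact_mod_cast hcn
    have hlog := div_mul_log_two_le_log h7
    push_cast at hlog
    have h10 : (4 * c : ℝ) * Real.log (4 * c) ≤ 4 * n * Real.log (4 * n) := by
      have : 0 ≤ Real.log (4 * c : ℝ) := Real.log_nonneg (by linarith)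
      gcongr
    have h11 : (b * 8000000 : ℝ) ≤ 4 * c * p * 693147 := by exact_mod_cast h8
    have h12 : (4 * c : ℝ) * (p / 8 * 0.693147) ≤ 4 * c * Real.log (4 * c) := by
      have := Real.log_two_gt_d9
      refine mul_le_mul_of_nonneg_left (le_trans ?_ hlog) (by positivity)
      gcongr
      linarith
    linarith
  have hπ := countCoprime_add_primeCounting_le d h1 h2 h3 h4
  have hpa : Nat.primeCounting a ≤ piR x := Nat.monotone_primeCounting (Nat.le_floor ha)
  have hpl : piR (x / 2) ≤ Nat.primeCounting l := by
    refine Nat.monotone_primeCounting ?_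
    rw [Nat.floor_div_ofNat]
    have := (Nat.floor_lt hx0).2 hb
    omega
  omega

theorem lt_primeCounting_sub_of_le {n : ℕ} {x : ℝ} (hx : 4 * n * Real.log (4 * n) ≤ x)
    (ha : (44 : ℕ) ≤ x) (hb : x < (32768 : ℕ)) : n < piR x - piR (x / 2) := by
  rcases lt_or_ge x (58 : ℕ) with hb' | ha
  · exact lt_primeCounting_sub_of_range 28 5 6 4 34 (by decide +kernel) hx ha hb'
  rcases lt_or_ge x (62 : ℕ) with hb' | ha
  · exact lt_primeCounting_sub_of_range 30 6 7 5 36 (by decide +kernel) hx ha hb'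
  rcases lt_or_ge x (74 : ℕ) with hb' | ha
  · exact lt_primeCounting_sub_of_range 36 7 7 5 38 (by decide +kernel) hx ha hb'
  rcases lt_or_ge x (92 : ℕ) with hb' | ha
  · exact lt_primeCounting_sub_of_range 45 7 8 5 38 (by decide +kernel) hx ha hb'
  rcases lt_or_ge x (110 : ℕ) with hb' | ha
  · exact lt_primeCounting_sub_of_range 54 8 9 6 40 (by decide +kernel) hx ha hb'
  rcases lt_or_ge x (142 : ℕ) with hb' | ha
  · exact lt_primeCounting_sub_of_range 70 10 10 6 42 (by decide +kernel) hx ha hb'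
  rcases lt_or_ge x (166 : ℕ) with hb' | ha
  · exact lt_primeCounting_sub_of_range 82 12 11 6 44 (by decide +kernel) hx ha hb'
  rcases lt_or_ge x (202 : ℕ) with hb' | ha
  · exact lt_primeCounting_sub_of_range 100 13 12 7 45 (by decide +kernel) hx ha hb'
  rcases lt_or_ge x (254 : ℕ) with hb' | ha
  · exact lt_primeCounting_sub_of_range 126 16 14 7 48 (by decide +kernel) hx ha hb'
  rcases lt_or_ge x (305 : ℕ) with hb' | ha
  · exact lt_primeCounting_sub_of_range 152 18 15 7 49 (by decide +kernel) hx ha hb'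
  rcases lt_or_ge x (362 : ℕ) with hb' | ha
  · exact lt_primeCounting_sub_of_range 180 21 17 7 51 (by decide +kernel) hx ha hb'
  rcases lt_or_ge x (446 : ℕ) with hb' | ha
  · exact lt_primeCounting_sub_of_range 222 25 19 8 53 (by decide +kernel) hx ha hb'
  rcases lt_or_ge x (542 : ℕ) with hb' | ha
  · exact lt_primeCounting_sub_of_range 270 29 21 8 54 (by decide +kernel) hx ha hb'
  rcases lt_or_ge x (659 : ℕ) with hb' | ha
  · exact lt_primeCounting_sub_of_range 329 34 23 8 56 (by decide +kernel) hx ha hb'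
  rcases lt_or_ge x (818 : ℕ) with hb' | ha
  · exact lt_primeCounting_sub_of_range 408 41 25 8 58 (by decide +kernel) hx ha hb'
  rcases lt_or_ge x (982 : ℕ) with hb' | ha
  · exact lt_primeCounting_sub_of_range 490 48 28 9 60 (by decide +kernel) hx ha hb'
  rcases lt_or_ge x (1202 : ℕ) with hb' | ha
  · exact lt_primeCounting_sub_of_range 600 56 31 9 62 (by decide +kernel) hx ha hb'
  rcases lt_or_ge x (1478 : ℕ) with hb' | ha
  · exact lt_primeCounting_sub_of_range 738 67 34 9 64 (by decide +kernel) hx ha hb'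
  rcases lt_or_ge x (1807 : ℕ) with hb' | ha
  · exact lt_primeCounting_sub_of_range 903 79 38 10 66 (by decide +kernel) hx ha hb'
  rcases lt_or_ge x (2215 : ℕ) with hb' | ha
  · exact lt_primeCounting_sub_of_range 1107 94 42 10 68 (by decide +kernel) hx ha hb'
  rcases lt_or_ge x (2722 : ℕ) with hb' | ha
  · exact lt_primeCounting_sub_of_range 1360 113 47 10 70 (by decide +kernel) hx ha hb'
  rcases lt_or_ge x (3343 : ℕ) with hb' | ha
  · exact lt_primeCounting_sub_of_range 1671 134 52 11 72 (by decide +kernel) hx ha hb'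
  rcases lt_or_ge x (4126 : ℕ) with hb' | ha
  · exact lt_primeCounting_sub_of_range 2062 161 57 11 74 (by decide +kernel) hx ha hb'
  rcases lt_or_ge x (5098 : ℕ) with hb' | ha
  · exact lt_primeCounting_sub_of_range 2548 194 64 11 76 (by decide +kernel) hx ha hb'
  rcases lt_or_ge x (6325 : ℕ) with hb' | ha
  · exact lt_primeCounting_sub_of_range 3162 234 71 11 78 (by decide +kernel) hx ha hb'
  rcases lt_or_ge x (7846 : ℕ) with hb' | ha
  · exact lt_primeCounting_sub_of_range 3922 280 79 12 81 (by decide +kernel) hx ha hb'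
  rcases lt_or_ge x (9751 : ℕ) with hb' | ha
  · exact lt_primeCounting_sub_of_range 4875 339 88 12 83 (by decide +kernel) hx ha hb'
  rcases lt_or_ge x (12137 : ℕ) with hb' | ha
  · exact lt_primeCounting_sub_of_range 6068 412 98 12 85 (by decide +kernel) hx ha hb'
  rcases lt_or_ge x (15046 : ℕ) with hb' | ha
  · exact lt_primeCounting_sub_of_range 7522 500 110 13 87 (by decide +kernel) hx ha hb'
  rcases lt_or_ge x (18638 : ℕ) with hb' | ha
  · exact lt_primeCounting_sub_of_range 9318 605 122 13 89 (by decide +kernel) hx ha hb'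
  rcases lt_or_ge x (23307 : ℕ) with hb' | ha
  · exact lt_primeCounting_sub_of_range 11653 731 136 13 92 (by decide +kernel) hx ha hb'
  rcases lt_or_ge x (29102 : ℕ) with hb' | ha
  · exact lt_primeCounting_sub_of_range 14550 894 152 14 94 (by decide +kernel) hx ha hb'
  exact lt_primeCounting_sub_of_range 16383 1263 170 14 98 (by decide +kernel) hx ha hb

section Chebyshev

open Finset ArithmeticFunction Chebyshev

theorem sum_vonMangoldt_mul_div (N : ℕ) :
    ∑ k ∈ Ioc 0 N, Λ k * ((N / k : ℕ) : ℝ) = Real.log (N.factorial) := by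
  rw [← sum_Ioc_mul_zeta_eq_sum, vonMangoldt_mul_zeta]
  induction N with
  | zero => simp
  | succ n ih =>
    rw [← Finset.insert_Ioc_right_eq_Ioc_add_one (by omega), sum_insert (by simp), ih,
      Nat.factorial_succ, Nat.cast_mul, Real.log_mul (by positivity) (by positivity), log_apply]

theorem sum_vonMangoldt_mul_div_div (N d : ℕ) :
    ∑ k ∈ Ioc 0 N, Λ k * ((N / k / d : ℕ) : ℝ) = Real.log ((N / d).factorial) := by
  rw [← sum_vonMangoldt_mul_div]
  symm
  refine (sum_subset (Ioc_subset_Ioc_right (Nat.div_le_self _ _)) fun k hk hk' => ?_).trans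
    (sum_congr rfl fun k _ => by rw [Nat.div_div_eq_div_mul, mul_comm d, Nat.div_div_eq_div_mul])
  simp only [mem_Ioc, not_and, not_le] at hk hk'
  simp [Nat.div_eq_of_lt (hk' hk.1)]

/-- The logarithm of the Chebyshev quotient `⌊x⌋! ⌊x / 30⌋! / (⌊x / 2⌋! ⌊x / 3⌋! ⌊x / 5⌋!)`. -/
noncomputable def logChebyshevQuotient (x : ℝ) : ℝ :=
  Real.log ⌊x⌋₊.factorial - Real.log ⌊x / 2⌋₊.factorial - Real.log ⌊x / 3⌋₊.factorial -
    Real.log ⌊x / 5⌋₊.factorial + Real.log ⌊x / 30⌋₊.factorial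

theorem logChebyshevQuotient_eq_sum (x : ℝ) :
    logChebyshevQuotient x = ∑ k ∈ Ioc 0 ⌊x⌋₊, Λ k *
      (((⌊x⌋₊ / k : ℕ) : ℝ) - (⌊x⌋₊ / k / 2 : ℕ) - (⌊x⌋₊ / k / 3 : ℕ) - (⌊x⌋₊ / k / 5 : ℕ) +
        (⌊x⌋₊ / k / 30 : ℕ)) := by
  simp only [mul_add, mul_sub, sum_add_distrib, sum_sub_distrib, sum_vonMangoldt_mul_div,
    sum_vonMangoldt_mul_div_div, logChebyshevQuotient, Nat.floor_div_ofNat]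

theorem logChebyshevQuotient_le_psi (x : ℝ) : logChebyshevQuotient x ≤ ψ x := by
  rw [logChebyshevQuotient_eq_sum, psi]
  refine sum_le_sum fun k _ => mul_le_of_le_one_right vonMangoldt_nonneg ?_
  generalize ⌊x⌋₊ / k = m
  have : m + m / 30 ≤ 1 + m / 2 + m / 3 + m / 5 := by omega
  have : (m + (m / 30 : ℕ) : ℝ) ≤ 1 + (m / 2 : ℕ) + (m / 3 : ℕ) + (m / 5 : ℕ) := by
    exact_mod_cast this
  linarith

theorem psi_le_logChebyshevQuotient_add (x : ℝ) : ψ x ≤ logChebyshevQuotient x + ψ (x / 6) := by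
  rw [logChebyshevQuotient_eq_sum, psi, psi, Nat.floor_div_ofNat]
  generalize ⌊x⌋₊ = N
  have hsub : Ioc 0 (N / 6) ⊆ Ioc 0 N := Ioc_subset_Ioc_right (Nat.div_le_self _ _)
  have hind : ∑ k ∈ Ioc 0 (N / 6), Λ k = ∑ k ∈ Ioc 0 N, if k ≤ N / 6 then Λ k else 0 := by
    rw [← sum_filter]
    refine sum_congr ?_ fun _ _ => rfl
    ext k
    simp only [mem_Ioc, mem_filter]
    omega
  rw [hind, ← sum_add_distrib]
  refine sum_le_sum fun k hk => ?_
  have hk0 : 0 < k := (mem_Ioc.1 hk).1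
  have hkN : k ≤ N := (mem_Ioc.1 hk).2
  have hΛ : 0 ≤ Λ k := vonMangoldt_nonneg
  have hm1 : 1 ≤ N / k := Nat.div_pos hkN hk0
  split_ifs with h
  · refine le_add_of_nonneg_left (mul_nonneg hΛ ?_)
    generalize N / k = m
    have : m / 2 + m / 3 + m / 5 ≤ m + m / 30 := by omega
    have : ((m / 2 : ℕ) + (m / 3 : ℕ) + (m / 5 : ℕ) : ℝ) ≤ m + (m / 30 : ℕ) := by
      exact_mod_cast this
    linarith
  · have hm5 : N / k < 6 := by
      rw [Nat.div_lt_iff_lt_mul hk0]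
      omega
    rw [add_zero]
    refine le_mul_of_one_le_right hΛ ?_
    generalize N / k = m at *
    interval_cases m <;> norm_num

theorem log_factorial_le {n : ℕ} (hn : n ≠ 0) :
    Real.log n.factorial ≤ n * Real.log n - n + 1 + Real.log n := by
  induction n, Nat.one_le_iff_ne_zero.2 hn using Nat.le_induction with
  | base => simp
  | succ n h1 ih =>
    have hn' : (0 : ℝ) < n := Nat.cast_pos.2 h1
    rw [Nat.factorial_succ, Nat.cast_mul, Real.log_mul (by positivity) (by positivity)]
    have h := Real.one_sub_inv_le_log_of_pos (x := (n + 1 : ℝ) / n) (by positivity)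
    rw [Real.log_div (by positivity) (by positivity)] at h
    have h2 : (n + 1 : ℝ) * (1 - ((n + 1 : ℝ) / n)⁻¹) = 1 := by field_simp; ring
    have h3 := mul_le_mul_of_nonneg_left h (show (0 : ℝ) ≤ n + 1 by positivity)
    have := ih (by omega)
    push_cast
    nlinarith

theorem le_log_factorial {n : ℕ} (hn : n ≠ 0) :
    n * Real.log n - n + 1 ≤ Real.log n.factorial := by
  induction n, Nat.one_le_iff_ne_zero.2 hn using Nat.le_induction with
  | base => simp
  | succ n h1 ih =>
    have hn' : (0 : ℝ) < n := Nat.cast_pos.2 h1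
    rw [Nat.factorial_succ, Nat.cast_mul, Real.log_mul (by positivity) (by positivity)]
    have h := Real.log_le_sub_one_of_pos (x := (n + 1 : ℝ) / n) (by positivity)
    rw [Real.log_div (by positivity) (by positivity)] at h
    have h2 : (n : ℝ) * ((n + 1 : ℝ) / n - 1) = 1 := by field_simp; ring
    have h3 := mul_le_mul_of_nonneg_left h hn'.le
    have := ih (by omega)
    push_cast
    nlinarith

theorem log_factorial_floor_le {x : ℝ} (hx : 1 ≤ x) :
    Real.log ⌊x⌋₊.factorial ≤ x * Real.log x - x + 1 + Real.log x := by
  have hN : 1 ≤ ⌊x⌋₊ := Nat.floor_pos.2 hx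
  have hN' : (1 : ℝ) ≤ ⌊x⌋₊ := by exact_mod_cast hN
  have hNx : (⌊x⌋₊ : ℝ) ≤ x := Nat.floor_le (by linarith)
  refine (log_factorial_le (by omega)).trans ?_
  generalize (⌊x⌋₊ : ℝ) = N at *
  have hlog : Real.log N ≤ Real.log x := Real.log_le_log (by linarith) hNx
  have h := Real.log_le_sub_one_of_pos (x := N / x) (by positivity)
  rw [Real.log_div (by positivity) (by positivity)] at h
  have h2 : x * (N / x - 1) = N - x := by field_simp
  have h3 := mul_le_mul_of_nonneg_left h (show 0 ≤ x by linarith)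
  have h4 := Real.log_nonneg hN'
  nlinarith

theorem le_log_factorial_floor {x : ℝ} (hx : 1 ≤ x) :
    x * Real.log x - x + 1 - Real.log x ≤ Real.log ⌊x⌋₊.factorial := by
  have hN : 1 ≤ ⌊x⌋₊ := Nat.floor_pos.2 hx
  have hN' : (1 : ℝ) ≤ ⌊x⌋₊ := by exact_mod_cast hN
  have hNx : (⌊x⌋₊ : ℝ) ≤ x := Nat.floor_le (by linarith)
  have hxN : x < ⌊x⌋₊ + 1 := Nat.lt_floor_add_one x
  refine le_trans ?_ (le_log_factorial (by omega))
  generalize (⌊x⌋₊ : ℝ) = N at *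
  have h := Real.log_le_sub_one_of_pos (x := x / N) (by positivity)
  rw [Real.log_div (by positivity) (by positivity)] at h
  have h2 : N * (x / N - 1) = x - N := by field_simp
  have h3 := mul_le_mul_of_nonneg_left h (show 0 ≤ N by linarith)
  have h4 := Real.log_nonneg hx
  nlinarith

theorem log_three_bounds :
    19 / 12 * Real.log 2 ≤ Real.log 3 ∧ Real.log 3 ≤ 65 / 41 * Real.log 2 := by
  have h1 := Real.log_le_log (by norm_num) (show (2 : ℝ) ^ 19 ≤ 3 ^ 12 by norm_num)
  have h2 := Real.log_le_log (by norm_num) (show (3 : ℝ) ^ 41 ≤ 2 ^ 65 by norm_num)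
  rw [Real.log_pow, Real.log_pow] at h1 h2
  push_cast at h1 h2
  constructor <;> linarith

theorem log_five_bounds :
    65 / 28 * Real.log 2 ≤ Real.log 5 ∧ Real.log 5 ≤ 72 / 31 * Real.log 2 := by
  have h1 := Real.log_le_log (by norm_num) (show (2 : ℝ) ^ 65 ≤ 5 ^ 28 by norm_num)
  have h2 := Real.log_le_log (by norm_num) (show (5 : ℝ) ^ 31 ≤ 2 ^ 72 by norm_num)
  rw [Real.log_pow, Real.log_pow] at h1 h2
  push_cast at h1 h2
  constructor <;> linarith

theorem logChebyshevQuotient_bounds {x : ℝ} (hx : 30 ≤ x) :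
    0.9208 * x - 5 * Real.log x ≤ logChebyshevQuotient x ∧
      logChebyshevQuotient x ≤ 0.9217 * x + 5 * Real.log x := by
  have l1 := log_factorial_floor_le (x := x) (by linarith)
  have l2 := log_factorial_floor_le (x := x / 2) (by linarith)
  have l3 := log_factorial_floor_le (x := x / 3) (by linarith)
  have l5 := log_factorial_floor_le (x := x / 5) (by linarith)
  have l30 := log_factorial_floor_le (x := x / 30) (by linarith)
  have u1 := le_log_factorial_floor (x := x) (by linarith)
  have u2 := le_log_factorial_floor (x := x / 2) (by linarith)
  have u3 := le_log_factorial_floor (x := x / 3) (by linarith)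
  have u5 := le_log_factorial_floor (x := x / 5) (by linarith)
  have u30 := le_log_factorial_floor (x := x / 30) (by linarith)
  have hx0 : x ≠ 0 := by linarith
  have e30 : Real.log 30 = Real.log 2 + Real.log 3 + Real.log 5 := by
    rw [← Real.log_mul (by norm_num) (by norm_num), ← Real.log_mul (by norm_num) (by norm_num)]
    norm_num
  rw [Real.log_div hx0 (by norm_num)] at l2 l3 l5 l30 u2 u3 u5 u30
  rw [e30] at l30 u30
  obtain ⟨a3, b3⟩ := log_three_bounds
  obtain ⟨a5, b5⟩ := log_five_bounds
  have a2 := Real.log_two_gt_d9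
  have b2 := Real.log_two_lt_d9
  have hA : 0.9208 ≤ 14 / 30 * Real.log 2 + 3 / 10 * Real.log 3 + 1 / 6 * Real.log 5 := by
    linarith
  have hB : 14 / 30 * Real.log 2 + 3 / 10 * Real.log 3 + 1 / 6 * Real.log 5 ≤ 0.9217 := by
    linarith
  have hA' := mul_le_mul_of_nonneg_right hA (show 0 ≤ x by linarith)
  have hB' := mul_le_mul_of_nonneg_right hB (show 0 ≤ x by linarith)
  rw [logChebyshevQuotient]
  constructor <;> linarith

theorem psi_le_mul_of_sq_le {s y : ℝ} (hs : Real.exp 1 ≤ s) (hy : s ^ 2 ≤ y) :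
    ψ y ≤ (Real.log 4 + 4 * (Real.log s / s)) * y := by
  have hs1 : 1 < s := lt_of_lt_of_le (by simp) hs
  have hy1 : 1 ≤ y := by nlinarith
  have hsy : s ≤ √y := Real.le_sqrt_of_sq_le hy
  have hanti := Real.log_div_self_antitoneOn (Set.mem_Ici.2 hs) (Set.mem_Ici.2 (hs.trans hsy)) hsy
  simp only at hanti
  rw [div_le_iff₀ (by linarith), Real.log_sqrt (by linarith)] at hanti
  have hsq : √y * √y = y := Real.mul_self_sqrt (by linarith)
  have hmul := mul_le_mul_of_nonneg_left hanti (Real.sqrt_nonneg y)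
  rw [mul_left_comm (√y) (Real.log s / s), hsq] at hmul
  have := Chebyshev.psi_le hy1
  linarith

theorem psi_sub_theta_le_of_le {x : ℝ} (hx : 32768 ≤ x) : ψ x - θ x ≤ 0.02 * x := by
  have hx0 : 0 ≤ x := by linarith
  have he := Real.exp_one_lt_d9
  have hl2 := Real.log_two_lt_d9
  have hl4 : Real.log 4 = 2 * Real.log 2 := by
    rw [show (4 : ℝ) = 2 ^ 2 by norm_num, Real.log_pow]; norm_num
  have hl8 : Real.log 8 = 3 * Real.log 2 := by
    rw [show (8 : ℝ) = 2 ^ 3 by norm_num, Real.log_pow]; norm_num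
  have h := Chebyshev.psi_sub_theta_le_psi_add_psi_add_psi x
  have h53 : ψ (x ^ (5 : ℝ)⁻¹) ≤ ψ (x ^ (3 : ℝ)⁻¹) :=
    Chebyshev.psi_mono (Real.rpow_le_rpow_of_exponent_le (by linarith) (by norm_num))
  have hz3 : (x ^ (3 : ℝ)⁻¹) ^ 3 = x := by
    rw [← Real.rpow_natCast, ← Real.rpow_mul hx0]; norm_num
  have hy2 : (x ^ (2 : ℝ)⁻¹) ^ 2 = x := by
    rw [← Real.rpow_natCast, ← Real.rpow_mul hx0]; norm_num
  have hz0 : 0 ≤ x ^ (3 : ℝ)⁻¹ := by positivity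
  have hy0 : 0 ≤ x ^ (2 : ℝ)⁻¹ := by positivity
  generalize x ^ (3 : ℝ)⁻¹ = z at *
  generalize x ^ (2 : ℝ)⁻¹ = y at *
  have hz : 32 ≤ z := le_of_pow_le_pow_left₀ (n := 3) (by norm_num) hz0 (by linarith)
  have hy : 181 ≤ y := le_of_pow_le_pow_left₀ (n := 2) (by norm_num) hy0 (by linarith)
  have hψz := psi_le_mul_of_sq_le (s := 4) (y := z) (by linarith) (by linarith)
  have hψy := psi_le_mul_of_sq_le (s := 8) (y := y) (by linarith) (by linarith)
  rw [hl4] at hψz hψy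
  rw [hl8] at hψy
  have hψz' : ψ z ≤ 2.78 * z := hψz.trans (mul_le_mul_of_nonneg_right (by linarith) hz0)
  have hψy' : ψ y ≤ 2.43 * y := hψy.trans (mul_le_mul_of_nonneg_right (by linarith) hy0)
  have hz2 : 1024 ≤ z ^ 2 := by nlinarith
  have hzx : 1024 * z ≤ x := by nlinarith [mul_le_mul_of_nonneg_left hz2 hz0]
  have hyx : 181 * y ≤ x := by nlinarith
  linarith

theorem mul_le_theta_sub_theta_half {x : ℝ} (hx : 32768 ≤ x) :
    0.32 * x ≤ θ x - θ (x / 2) := by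
  have hl2 := Real.log_two_lt_d9
  have he := Real.exp_one_lt_d9
  have hl4 : Real.log 4 = 2 * Real.log 2 := by
    rw [show (4 : ℝ) = 2 ^ 2 by norm_num, Real.log_pow]; norm_num
  have hl16 : Real.log 16 = 4 * Real.log 2 := by
    rw [show (16 : ℝ) = 2 ^ 4 by norm_num, Real.log_pow]; norm_num
  have hlx : Real.log x ≤ 15 * Real.log 2 + (x / 32768 - 1) := by
    have h := Real.log_le_sub_one_of_pos (x := x / 2 ^ 15) (by positivity)
    rw [Real.log_div (by linarith) (by norm_num), Real.log_pow] at h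
    norm_num at h ⊢
    linarith
  have h1 := (logChebyshevQuotient_bounds (x := x) (by linarith)).1
  have h2 := (logChebyshevQuotient_bounds (x := x / 2) (by linarith)).2
  have h3 := (logChebyshevQuotient_bounds (x := x / 2 / 6) (by linarith)).2
  have h4 := logChebyshevQuotient_le_psi x
  have h5 := psi_le_logChebyshevQuotient_add (x / 2)
  have h6 := psi_le_logChebyshevQuotient_add (x / 2 / 6)
  have h7 := psi_le_mul_of_sq_le (s := 16) (y := x / 2 / 6 / 6) (by linarith) (by linarith)
  have h8 := psi_sub_theta_le_of_le hx
  have h9 := Chebyshev.theta_le_psi (x / 2)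
  have h10 : Real.log (x / 2) ≤ Real.log x := Real.log_le_log (by linarith) (by linarith)
  have h11 : Real.log (x / 2 / 6) ≤ Real.log x := Real.log_le_log (by linarith) (by linarith)
  rw [hl4, hl16] at h7
  have h12 : ψ (x / 2 / 6 / 6) ≤ 2.08 * (x / 2 / 6 / 6) :=
    h7.trans (mul_le_mul_of_nonneg_right (by linarith) (by linarith))
  linarith

theorem theta_le_theta_add_primeCounting_sub_mul_log {x y : ℝ} (hy : 0 ≤ y) (hyx : y ≤ x) :
    θ x ≤ θ y + (Nat.primeCounting ⌊x⌋₊ - Nat.primeCounting ⌊y⌋₊ : ℝ) * Real.log x := by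
  have hsub : Nat.primesLE ⌊y⌋₊ ⊆ Nat.primesLE ⌊x⌋₊ := by
    intro p hp
    rw [Nat.mem_primesLE] at *
    exact ⟨hp.1.trans (Nat.floor_mono hyx), hp.2⟩
  rw [Chebyshev.theta_eq_sum_primesLE, Chebyshev.theta_eq_sum_primesLE,
    ← sum_sdiff hsub, add_comm, ← Nat.primesLE_card_eq_primeCounting,
    ← Nat.primesLE_card_eq_primeCounting, ← Nat.cast_sub (card_le_card hsub),
    ← card_sdiff_of_subset hsub, ← nsmul_eq_mul]
  gcongr
  refine sum_le_card_nsmul _ _ _ fun p hp => ?_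
  have hp' := Nat.mem_primesLE.1 (mem_sdiff.1 hp).1
  exact Real.log_le_log (by exact_mod_cast hp'.2.pos)
    ((Nat.le_floor_iff (hy.trans hyx)).1 hp'.1)

theorem lt_primeCounting_sub_of_ge {n : ℕ} (hn : 1 ≤ n) {x : ℝ}
    (hx : 4 * n * Real.log (4 * n) ≤ x) (ha : 32768 ≤ x) : n < piR x - piR (x / 2) := by
  by_contra! hle
  have hn' : (1 : ℝ) ≤ n := by exact_mod_cast hn
  have hle' : (piR x - piR (x / 2) : ℝ) ≤ n := by
    have : piR x ≤ n + piR (x / 2) := by omega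
    have : (piR x : ℝ) ≤ n + piR (x / 2) := by exact_mod_cast this
    linarith
  have hl2 := Real.log_two_gt_d9
  have hl2' := Real.log_two_lt_d9
  have hu : 15 * Real.log 2 ≤ Real.log x := by
    have h := Real.log_le_log (by norm_num) (show (2 : ℝ) ^ 15 ≤ x by linarith)
    rw [Real.log_pow] at h
    exact_mod_cast h
  have hu0 : 0 < Real.log x := by linarith
  have h1 := theta_le_theta_add_primeCounting_sub_mul_log
    (show 0 ≤ x / 2 by linarith) (show x / 2 ≤ x by linarith)
  have h2 := mul_le_theta_sub_theta_half ha
  have h3 := mul_le_mul_of_nonneg_right hle' hu0.le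
  simp only [piR] at h3
  have h4 : 1.28 * x / Real.log x ≤ 4 * n := by
    rw [div_le_iff₀ hu0]
    linarith
  have hw : 0 < 1.28 * x / Real.log x := by positivity
  have h5 := Real.log_le_log hw h4
  have h6 : 1.28 * x / Real.log x * Real.log (1.28 * x / Real.log x) ≤ x :=
    (mul_le_mul_of_nonneg_left h5 hw.le).trans <|
      (mul_le_mul_of_nonneg_right h4 (Real.log_nonneg (by linarith))).trans hx
  rw [Real.log_div (by positivity) hu0.ne', Real.log_mul (by norm_num) (by linarith),
    div_mul_eq_mul_div, div_le_iff₀ hu0, mul_comm (1.28 : ℝ) x, mul_assoc] at h6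
  have h7 := le_of_mul_le_mul_left h6 (by linarith)
  have h8 := Real.one_sub_inv_le_log_of_pos (x := 1.28) (by norm_num)
  have h9 := Real.log_le_sub_one_of_pos (x := Real.log x / 2 ^ 3) (by positivity)
  rw [Real.log_div hu0.ne' (by norm_num), Real.log_pow] at h9
  norm_num at h7 h8 h9
  linarith

end Chebyshev

theorem pi_sub_pi_half_gt (n : ℕ) (hn : 4 ≤ n) (x : ℝ)
    (hx : 4 * n * Real.log (4 * n) ≤ x) : n < piR x - piR (x / 2) := by
  rcases lt_or_ge x (32768 : ℕ) with hb | ha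
  · refine lt_primeCounting_sub_of_le hx ?_ hb
    have hn' : (4 : ℝ) ≤ n := by exact_mod_cast hn
    have hl2 := Real.log_two_gt_d9
    have hlog := Real.log_le_log (by norm_num) (show (2 : ℝ) ^ 4 ≤ 4 * n by linarith)
    rw [Real.log_pow] at hlog
    push_cast at hlog ⊢
    nlinarith
  · exact lt_primeCounting_sub_of_ge (by omega) hx (by exact_mod_cast ha)
end

section
/- For every ε > 0 there exists a positive integer n_0 such that for all integers n ≥ n_0, the n-th Ramanujan prime satisfies R_n < (2 + ε)·n·log n. -/
open MeasureTheory Filter Topology Set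

/-- The Fejér kernel, the Fourier transform of `tent`. -/
noncomputable def fejerKernel (w : ℝ) : ℝ := Real.sinc (w / 2) ^ 2

/-- The tent function supported on `[-1, 1]`. -/
noncomputable def tent (τ : ℝ) : ℝ := max 0 (1 - |τ|)

lemma continuous_fejerKernel : Continuous fejerKernel := by
  unfold fejerKernel
  exact (Real.continuous_sinc.comp (continuous_id.div_const 2)).pow 2

lemma fejerKernel_nonneg (w : ℝ) : 0 ≤ fejerKernel w := sq_nonneg _

lemma fejerKernel_le (w : ℝ) : fejerKernel w ≤ 8 * (1 + w ^ 2)⁻¹ := by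
  unfold fejerKernel
  have h1 : Real.sinc (w / 2) ^ 2 ≤ 1 := by
    rw [← sq_abs]
    exact pow_le_one₀ (abs_nonneg _) (Real.abs_sinc_le_one _)
  have h2 : w ^ 2 * Real.sinc (w / 2) ^ 2 ≤ 4 := by
    rcases eq_or_ne w 0 with rfl | hw
    · simp
    · rw [Real.sinc_of_ne_zero (by positivity)]
      have := Real.sin_sq_le_one (w / 2)
      field_simp
      linarith
  rw [← div_eq_mul_inv, le_div_iff₀ (by positivity)]
  linarith

lemma integrable_fejerKernel : Integrable fejerKernel := by
  refine (integrable_inv_one_add_sq.const_mul 8).mono'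
    continuous_fejerKernel.aestronglyMeasurable (Eventually.of_forall fun w ↦ ?_)
  rw [Real.norm_eq_abs, abs_of_nonneg (fejerKernel_nonneg w)]
  exact fejerKernel_le w

lemma integral_fejerKernel_pos : 0 < ∫ w, fejerKernel w := by
  rw [integral_pos_iff_support_of_nonneg fejerKernel_nonneg integrable_fejerKernel]
  exact continuous_fejerKernel.isOpen_support.measure_pos _ ⟨0, by simp [fejerKernel]⟩

lemma continuous_tent : Continuous tent := by unfold tent; fun_prop

lemma tent_nonneg (τ : ℝ) : 0 ≤ tent τ := le_max_left _ _

lemma tent_eq_zero {τ : ℝ} (h : τ ∉ Ioc (-1 : ℝ) 1) : tent τ = 0 := by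
  unfold tent
  refine max_eq_left ?_
  by_contra! hc
  have := abs_lt.mp (show |τ| < 1 by linarith)
  exact h ⟨this.1, this.2.le⟩

lemma integrable_tent : Integrable tent := by
  refine continuous_tent.integrable_of_hasCompactSupport ?_
  refine HasCompactSupport.intro (isCompact_Icc (a := -1) (b := 1)) fun x hx ↦ tent_eq_zero ?_
  exact fun h ↦ hx (Ioc_subset_Icc_self h)

lemma integral_one_sub_mul_cexp {c : ℂ} (hc : c ≠ 0) :
    ∫ τ in (0 : ℝ)..1, (1 - τ : ℂ) * Complex.exp (c * τ) =
      Complex.exp c / c ^ 2 - 1 / c - 1 / c ^ 2 := by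
  have hd (τ : ℝ) : HasDerivAt
      (fun τ : ℝ ↦ (1 - τ : ℂ) * Complex.exp (c * τ) / c + Complex.exp (c * τ) / c ^ 2)
      ((1 - τ : ℂ) * Complex.exp (c * τ)) τ := by
    have h1 : HasDerivAt (fun τ : ℝ ↦ (τ : ℂ)) 1 τ := Complex.ofRealCLM.hasDerivAt
    have h2 : HasDerivAt (fun τ : ℝ ↦ Complex.exp (c * τ)) (Complex.exp (c * τ) * (c * 1)) τ :=
      (h1.const_mul c).cexp
    convert! (((h1.const_sub 1).mul h2).div_const c).add (h2.div_const (c ^ 2)) using 1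
    field_simp
    ring
  rw [intervalIntegral.integral_eq_sub_of_hasDerivAt (fun τ _ ↦ hd τ)
    (Continuous.intervalIntegrable (by fun_prop) _ _)]
  simp
  ring

lemma integral_one_sub : ∫ τ in (0 : ℝ)..1, (1 - τ : ℂ) = 1 / 2 := by
  have : ∫ τ in (0 : ℝ)..1, (1 - τ : ℝ) = 1 / 2 := by
    rw [intervalIntegral.integral_sub (by simp) (by simp)]
    norm_num
  rw [← Complex.ofReal_inj, ← intervalIntegral.integral_ofReal] at this
  simpa using this

lemma integral_tent_mul_cexp (w : ℝ) :
    ∫ τ : ℝ, (tent τ : ℂ) * Complex.exp (Complex.I * w * τ) = fejerKernel w := by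
  set f : ℝ → ℂ := fun τ ↦ (tent τ : ℂ) * Complex.exp (Complex.I * w * τ) with hf
  have hfc : Continuous f := by
    have := continuous_tent
    fun_prop
  have hI : ∫ τ, f τ = ∫ τ in (-1 : ℝ)..1, f τ := by
    rw [intervalIntegral.integral_of_le (by norm_num), setIntegral_eq_integral_of_forall_compl_eq_zero]
    intro τ hτ
    simp [f, tent_eq_zero hτ]
  have hneg : ∫ τ in (-1 : ℝ)..0, f τ = ∫ τ in (0 : ℝ)..1, f (-τ) := by
    simp
  have h1 : ∫ τ in (0 : ℝ)..1, f τ =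
      ∫ τ in (0 : ℝ)..1, (1 - τ : ℂ) * Complex.exp ((Complex.I * w) * τ) := by
    refine intervalIntegral.integral_congr fun τ hτ ↦ ?_
    rw [uIcc_of_le zero_le_one] at hτ
    simp [f, tent, abs_of_nonneg hτ.1, hτ.2]
  have h2 : ∫ τ in (0 : ℝ)..1, f (-τ) =
      ∫ τ in (0 : ℝ)..1, (1 - τ : ℂ) * Complex.exp ((-(Complex.I * w)) * τ) := by
    refine intervalIntegral.integral_congr fun τ hτ ↦ ?_
    rw [uIcc_of_le zero_le_one] at hτ
    simp [f, tent, abs_of_nonneg hτ.1, hτ.2]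
  rw [hI, ← intervalIntegral.integral_add_adjacent_intervals
    (hfc.intervalIntegrable (-1) 0) (hfc.intervalIntegrable 0 1), hneg, h1, h2]
  rcases eq_or_ne w 0 with rfl | hw
  · simp [integral_one_sub, fejerKernel]
    norm_num
  · have hc : Complex.I * w ≠ 0 := by simp [hw]
    rw [integral_one_sub_mul_cexp hc, integral_one_sub_mul_cexp (neg_ne_zero.mpr hc), fejerKernel,
      Real.sinc_of_ne_zero (by positivity), div_pow, Real.sin_sq_eq_half_sub,
      mul_div_cancel₀ _ two_ne_zero]
    have hw' : (w : ℂ) ≠ 0 := by exact_mod_cast hw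
    push_cast
    rw [Complex.cos]
    have hI2 := Complex.I_sq
    rw [neg_sq, mul_pow, hI2, show -(Complex.I * (w : ℂ)) = -w * Complex.I by ring,
      mul_comm Complex.I (w : ℂ)]
    field_simp
    ring

lemma integrable_mul_fejerKernel {b : ℝ → ℝ} (hb : Measurable b) {C : ℝ} (hC : ∀ u, |b u| ≤ C)
    {l : ℝ} (hl : l ≠ 0) (v : ℝ) : Integrable (fun u ↦ b u * fejerKernel (l * (v - u))) := by
  refine Integrable.bdd_mul (c := C) ?_ hb.aestronglyMeasurable (Eventually.of_forall hC)
  exact (integrable_fejerKernel.comp_mul_left' hl).comp_sub_left v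

/-- Smoothing by the Fejér kernel expressed through the Laplace transform, away from the boundary
line. -/
lemma integral_exp_mul_fejerKernel {b : ℝ → ℝ} (hb : Measurable b) {C : ℝ} (hC : ∀ u, |b u| ≤ C)
    (hb0 : ∀ u ≤ 0, b u = 0) {H : ℂ → ℂ}
    (hH : ∀ z : ℂ, 0 < z.re → ∫ u : ℝ, (b u : ℂ) * Complex.exp (-z * u) = H z)
    (l v : ℝ) {δ : ℝ} (hδ : 0 < δ) :
    ((∫ u, Real.exp (-δ * u) * (b u * fejerKernel (l * (v - u))) : ℝ) : ℂ) =
      ∫ τ : ℝ, Complex.exp (Complex.I * (l * v) * τ) * (tent τ * H (δ + Complex.I * (l * τ))) := by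
  have hint : Integrable (fun u ↦ b u * Real.exp (-δ * u)) := by
    have h1 : IntegrableOn (fun u ↦ Real.exp (-δ * u)) (Ioi 0) := by
      simpa using exp_neg_integrableOn_Ioi 0 hδ
    have h2 : IntegrableOn (fun u ↦ b u * Real.exp (-δ * u)) (Ioi 0) :=
      Integrable.bdd_mul (c := C) h1 hb.aestronglyMeasurable (Eventually.of_forall hC)
    refine (integrableOn_iff_integrable_of_support_subset fun u hu ↦ ?_).mp h2
    by_contra hcon
    exact hu (by simp [hb0 u (not_lt.mp hcon)])
  have hprod : Integrable (Function.uncurry fun (u τ : ℝ) ↦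
      (((b u * Real.exp (-δ * u) : ℝ) : ℂ) * (tent τ : ℂ)) *
        Complex.exp (Complex.I * ((l * (v - u)) * τ : ℝ))) := by
    have h := (hint.ofReal (𝕜 := ℂ)).mul_prod (integrable_tent.ofReal (𝕜 := ℂ))
    refine h.mul_bdd (c := 1) (Continuous.aestronglyMeasurable (by fun_prop))
      (Eventually.of_forall fun p ↦ ?_)
    rw [mul_comm, Complex.norm_exp_ofReal_mul_I]
  calc _ = ∫ u : ℝ, ∫ τ : ℝ, (((b u * Real.exp (-δ * u) : ℝ) : ℂ) * (tent τ : ℂ)) *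
        Complex.exp (Complex.I * ((l * (v - u)) * τ : ℝ)) := by
        rw [← integral_complex_ofReal]
        congr 1 with u
        simp_rw [mul_assoc]
        rw [integral_const_mul]
        have := integral_tent_mul_cexp (l * (v - u))
        simp only [Complex.ofReal_mul, mul_assoc] at this ⊢
        rw [this]
        ring
    _ = ∫ τ : ℝ, ∫ u : ℝ, (((b u * Real.exp (-δ * u) : ℝ) : ℂ) * (tent τ : ℂ)) *
        Complex.exp (Complex.I * ((l * (v - u)) * τ : ℝ)) := integral_integral_swap hprod
    _ = _ := by
        congr 1 with τ
        rw [← hH _ (by simp [hδ]), ← integral_const_mul, ← integral_const_mul]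
        congr 1 with u
        have : Complex.exp (-δ * u) * Complex.exp (Complex.I * ((l * (v - u)) * τ)) =
            Complex.exp (Complex.I * (l * v) * τ) *
              Complex.exp (-(δ + Complex.I * (l * τ)) * u) := by
          rw [← Complex.exp_add, ← Complex.exp_add]
          ring_nf
        push_cast
        linear_combination (b u * tent τ : ℂ) * this

/-- Smoothing by the Fejér kernel expressed through the boundary values of the Laplace
transform. -/
lemma integral_mul_fejerKernel {b : ℝ → ℝ} (hb : Measurable b) {C : ℝ} (hC : ∀ u, |b u| ≤ C)
    (hb0 : ∀ u ≤ 0, b u = 0) {H : ℂ → ℂ} (hHc : ContinuousOn H {z | 0 ≤ z.re})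
    (hH : ∀ z : ℂ, 0 < z.re → ∫ u : ℝ, (b u : ℂ) * Complex.exp (-z * u) = H z)
    {l : ℝ} (hl : l ≠ 0) (v : ℝ) :
    ((∫ u, b u * fejerKernel (l * (v - u)) : ℝ) : ℂ) =
      ∫ τ : ℝ, Complex.exp (Complex.I * (l * v) * τ) * (tent τ * H (Complex.I * (l * τ))) := by
  have hlhs : Tendsto (fun δ : ℝ ↦ ∫ u, Real.exp (-δ * u) * (b u * fejerKernel (l * (v - u))))
      (𝓝[>] 0) (𝓝 (∫ u, b u * fejerKernel (l * (v - u)))) := by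
    refine tendsto_integral_filter_of_dominated_convergence
      (fun u ↦ ‖b u * fejerKernel (l * (v - u))‖) ?_ ?_
      (integrable_mul_fejerKernel hb hC hl v).norm ?_
    · refine Eventually.of_forall fun δ ↦ ?_
      exact (Continuous.aestronglyMeasurable (by fun_prop)).mul
        (integrable_mul_fejerKernel hb hC hl v).aestronglyMeasurable
    · filter_upwards [self_mem_nhdsWithin] with δ hδ
      refine Eventually.of_forall fun u ↦ ?_
      rcases le_or_gt u 0 with hu | hu
      · simp [hb0 u hu]
      · rw [norm_mul]
        refine mul_le_of_le_one_left (norm_nonneg _) ?_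
        rw [Real.norm_eq_abs, Real.abs_exp, Real.exp_le_one_iff]
        have : (0 : ℝ) < δ := hδ
        nlinarith
    · refine Eventually.of_forall fun u ↦ ?_
      have : Tendsto (fun δ : ℝ ↦ Real.exp (-δ * u) * (b u * fejerKernel (l * (v - u))))
          (𝓝 0) (𝓝 (Real.exp (-0 * u) * (b u * fejerKernel (l * (v - u))))) :=
        Continuous.tendsto (by fun_prop) 0
      simpa using this.mono_left nhdsWithin_le_nhds
  have hcont : Continuous fun p : ℝ × ℝ ↦ H ((max 0 p.1 : ℝ) + Complex.I * (l * p.2)) := by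
    refine hHc.comp_continuous (by fun_prop) fun p ↦ ?_
    simp
  obtain ⟨M, hM⟩ := (isCompact_Icc.prod isCompact_Icc :
    IsCompact (Icc (0 : ℝ) 1 ×ˢ Icc (-1 : ℝ) 1)).exists_bound_of_continuousOn hcont.continuousOn
  have hrhs : Tendsto (fun δ : ℝ ↦ ∫ τ : ℝ, Complex.exp (Complex.I * (l * v) * τ) *
      (tent τ * H (δ + Complex.I * (l * τ)))) (𝓝[>] 0)
      (𝓝 (∫ τ : ℝ, Complex.exp (Complex.I * (l * v) * τ) *
        (tent τ * H (Complex.I * (l * τ))))) := by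
    refine tendsto_integral_filter_of_dominated_convergence (fun τ ↦ tent τ * M) ?_ ?_
      (integrable_tent.mul_const M) ?_
    · filter_upwards [self_mem_nhdsWithin] with δ hδ
      have h1 : Continuous fun τ : ℝ ↦ H (δ + Complex.I * (l * τ)) := by
        have := hcont.comp (Continuous.prodMk_right δ)
        simpa [Function.comp_def, max_eq_right (le_of_lt (show (0 : ℝ) < δ from hδ))] using this
      have h2 := continuous_tent
      exact ((by fun_prop : Continuous fun τ : ℝ ↦ Complex.exp (Complex.I * (l * v) * τ)).mul
        ((Complex.continuous_ofReal.comp h2).mul h1)).aestronglyMeasurable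
    · filter_upwards [Ioc_mem_nhdsGT zero_lt_one] with δ hδ
      refine Eventually.of_forall fun τ ↦ ?_
      have he : ‖Complex.exp (Complex.I * (l * v) * τ)‖ = 1 := by
        have := Complex.norm_exp_ofReal_mul_I (l * v * τ)
        push_cast at this
        rw [← this]
        congr 2
        ring
      rw [norm_mul, he, one_mul, norm_mul, Complex.norm_real, Real.norm_eq_abs,
        abs_of_nonneg (tent_nonneg τ)]
      by_cases hτ : τ ∈ Ioc (-1 : ℝ) 1
      · refine mul_le_mul_of_nonneg_left ?_ (tent_nonneg τ)
        have := hM (δ, τ) ⟨Ioc_subset_Icc_self hδ, Ioc_subset_Icc_self hτ⟩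
        simpa [max_eq_right hδ.1.le] using this
      · simp [tent_eq_zero hτ]
    · refine Eventually.of_forall fun τ ↦ ?_
      refine Tendsto.const_mul _ (Tendsto.const_mul _ ?_)
      have h1 := (hcont.comp (Continuous.prodMk_left τ)).tendsto 0
      simp only [Function.comp_def, max_self, Complex.ofReal_zero, zero_add] at h1
      refine (h1.mono_left nhdsWithin_le_nhds).congr' ?_
      filter_upwards [self_mem_nhdsWithin] with δ hδ
      simp [max_eq_right (le_of_lt (show (0 : ℝ) < δ from hδ))]
  refine tendsto_nhds_unique ((Complex.continuous_ofReal.tendsto _).comp hlhs) ?_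
  refine hrhs.congr' ?_
  filter_upwards [self_mem_nhdsWithin] with δ hδ
  exact (integral_exp_mul_fejerKernel hb hC hb0 hH l v hδ).symm

lemma tendsto_integral_mul_fejerKernel {b : ℝ → ℝ} (hb : Measurable b) {C : ℝ}
    (hC : ∀ u, |b u| ≤ C)
    (hb0 : ∀ u ≤ 0, b u = 0) {H : ℂ → ℂ} (hHc : ContinuousOn H {z | 0 ≤ z.re})
    (hH : ∀ z : ℂ, 0 < z.re → ∫ u : ℝ, (b u : ℂ) * Complex.exp (-z * u) = H z)
    {l : ℝ} (hl : 0 < l) :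
    Tendsto (fun v ↦ ∫ u, b u * fejerKernel (l * (v - u))) atTop (𝓝 0) := by
  have h1 := Real.tendsto_integral_exp_smul_cocompact
    fun τ : ℝ ↦ (tent τ * H (Complex.I * (l * τ)) : ℂ)
  have h2 : Tendsto (fun v : ℝ ↦ (-(l / (2 * Real.pi))) * v) atTop (cocompact ℝ) := by
    refine Tendsto.mono_right ?_ atBot_le_cocompact
    exact tendsto_id.const_mul_atTop_of_neg (by have := Real.pi_pos; simp; positivity)
  refine ((Complex.continuous_re.tendsto 0).comp (h1.comp h2)).congr fun v ↦ ?_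
  rw [← Complex.ofReal_re (∫ u, b u * fejerKernel (l * (v - u))),
    integral_mul_fejerKernel hb hC hb0 hHc hH hl.ne' v]
  simp only [Function.comp_def]
  congr 2 with τ
  rw [Circle.smul_def, Real.fourierChar_apply, smul_eq_mul]
  congr 2
  have := Real.pi_ne_zero
  push_cast
  field_simp

/-- A bounded function whose Fejér means tend to zero cannot stay above a positive level on
arbitrarily late windows of fixed width. -/
lemma eventually_exists_lt_of_tendsto_integral_mul_fejerKernel {f : ℝ → ℝ} (hf : Measurable f)
    {C : ℝ} (hC : ∀ u, |f u| ≤ C)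
    (hlim : ∀ l > 0, Tendsto (fun v ↦ ∫ u, f u * fejerKernel (l * (v - u))) atTop (𝓝 0))
    {h η : ℝ} (hh : 0 < h) (hη : 0 < η) :
    ∀ᶠ v in atTop, ∃ u ∈ Ioc (v - h) (v + h), f u < η := by
  set I := ∫ w, fejerKernel w with hI
  have hIpos : 0 < I := integral_fejerKernel_pos
  have hC0 : 0 ≤ C := (abs_nonneg _).trans (hC 0)
  have hd : 0 < η * I / (2 * (η + C)) := by positivity
  obtain ⟨R, hRpos, hR⟩ : ∃ R > 0,
      I - η * I / (2 * (η + C)) < ∫ w in (-R)..R, fejerKernel w := by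
    have := intervalIntegral_tendsto_integral integrable_fejerKernel tendsto_neg_atTop_atBot
      tendsto_id
    have h1 := this.eventually (lt_mem_nhds (sub_lt_self I hd))
    obtain ⟨R, h2, h3⟩ := ((eventually_gt_atTop 0).and h1).exists
    exact ⟨R, h2, h3⟩
  set l := R / h with hl
  have hlpos : 0 < l := by positivity
  have hlh : l * h = R := div_mul_cancel₀ _ hh.ne'
  filter_upwards [(hlim l hlpos).eventually
    (gt_mem_nhds (show 0 < l⁻¹ * (η * I / 2) by positivity))] with v hv
  by_contra! hcon
  refine hv.not_ge ?_
  have hK : Integrable fun u ↦ fejerKernel (l * (v - u)) :=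
    (integrable_fejerKernel.comp_mul_left' hlpos.ne').comp_sub_left v
  have htot : ∫ u, fejerKernel (l * (v - u)) = l⁻¹ * I := by
    rw [integral_sub_left_eq_self (fun u ↦ fejerKernel (l * u)) volume v,
      Measure.integral_comp_mul_left, abs_of_pos (inv_pos.mpr hlpos), smul_eq_mul]
  have hwin : ∫ u in Ioc (v - h) (v + h), fejerKernel (l * (v - u)) =
      l⁻¹ * ∫ w in (-R)..R, fejerKernel w := by
    rw [← intervalIntegral.integral_of_le (by linarith)]
    simp_rw [mul_sub]
    rw [intervalIntegral.integral_comp_sub_mul _ hlpos.ne', smul_eq_mul, ← hlh]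
    congr 2 <;> ring
  calc l⁻¹ * (η * I / 2)
      = (η + C) * (l⁻¹ * (I - η * I / (2 * (η + C)))) - C * (l⁻¹ * I) := by
        have : η + C ≠ 0 := by positivity
        field_simp
        ring
    _ ≤ (η + C) * (∫ u in Ioc (v - h) (v + h), fejerKernel (l * (v - u))) -
          C * ∫ u, fejerKernel (l * (v - u)) := by
        rw [htot, hwin]
        gcongr
    _ = ∫ u, ((η + C) * (Ioc (v - h) (v + h)).indicator
          (fun u ↦ fejerKernel (l * (v - u))) u - C * fejerKernel (l * (v - u))) := by
        rw [integral_sub ((hK.indicator measurableSet_Ioc).const_mul _) (hK.const_mul _),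
          integral_const_mul, integral_const_mul, integral_indicator measurableSet_Ioc]
    _ ≤ ∫ u, f u * fejerKernel (l * (v - u)) := by
        refine integral_mono
          (((hK.indicator measurableSet_Ioc).const_mul _).sub (hK.const_mul _))
          (integrable_mul_fejerKernel hf hC hlpos.ne' v) fun u ↦ ?_
        have hk := fejerKernel_nonneg (l * (v - u))
        by_cases hu : u ∈ Ioc (v - h) (v + h)
        · have := mul_le_mul_of_nonneg_right (hcon u hu) hk
          simp only [indicator_of_mem hu]
          linarith
        · have := mul_le_mul_of_nonneg_right (neg_le_of_abs_le (hC u)) hk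
          simp only [indicator_of_notMem hu]
          linarith

/-- A Tauberian theorem of Wiener–Ikehara type for bounded functions `b` such that
`(1 + b u) * exp u` is monotone. -/
theorem tendsto_zero_of_laplace_continuousOn {b : ℝ → ℝ} (hb : Measurable b) {C : ℝ}
    (hC : ∀ u, |b u| ≤ C) (hb0 : ∀ u ≤ 0, b u = 0)
    (hmono : ∀ u v, 0 < u → u ≤ v → (1 + b u) * Real.exp (u - v) ≤ 1 + b v)
    (hbge : ∀ u, -1 ≤ b u)
    {H : ℂ → ℂ} (hHc : ContinuousOn H {z | 0 ≤ z.re})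
    (hH : ∀ z : ℂ, 0 < z.re → ∫ u : ℝ, (b u : ℂ) * Complex.exp (-z * u) = H z) :
    Tendsto b atTop (𝓝 0) := by
  have hlim (l : ℝ) (hl : l > 0) := tendsto_integral_mul_fejerKernel hb hC hb0 hHc hH hl
  have hlim' : ∀ l > 0,
      Tendsto (fun v ↦ ∫ u, (-b) u * fejerKernel (l * (v - u))) atTop (𝓝 0) := by
    intro l hl
    simpa [integral_neg] using (hlim l hl).neg
  rw [Metric.tendsto_nhds]
  intro ε hε
  set η := min ε 1 with hη
  have hη0 : 0 < η := lt_min hε one_pos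
  have hη1 : η ≤ 1 := min_le_right _ _
  have hup := eventually_exists_lt_of_tendsto_integral_mul_fejerKernel hb hC hlim
    (h := η / 8) (η := η / 2) (by positivity) (by positivity)
  have hlo := eventually_exists_lt_of_tendsto_integral_mul_fejerKernel hb.neg
    (fun u ↦ by simpa using hC u) hlim' (h := η / 8) (η := η / 2) (by positivity) (by positivity)
  filter_upwards [(tendsto_atTop_add_const_right _ (η / 8) tendsto_id).eventually hup,
    (tendsto_atTop_add_const_right _ (-(η / 8)) tendsto_id).eventually hlo,
    eventually_gt_atTop 1] with v ⟨u, hu, hbu⟩ ⟨u', hu', hbu'⟩ hv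
  simp only [id, mem_Ioc, Pi.neg_apply] at hu hu' hbu'
  rw [Real.dist_eq, sub_zero]
  refine lt_of_lt_of_le ?_ (min_le_left ε 1)
  rw [← hη, abs_lt]
  constructor
  · have h1 := hmono u' v (by linarith) (by linarith)
    have h2 : 1 - η / 4 ≤ Real.exp (u' - v) := by
      have := Real.add_one_le_exp (u' - v)
      linarith
    have h3 := mul_le_mul (show 1 - η / 2 ≤ 1 + b u' by linarith) h2 (by linarith)
      (by linarith)
    nlinarith
  · have h1 := hmono v u (by linarith) (by linarith)
    have h2 : 1 - η / 4 ≤ Real.exp (v - u) := by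
      have := Real.add_one_le_exp (v - u)
      linarith
    have h3 := mul_le_mul_of_nonneg_left h2 (show 0 ≤ 1 + b v by linarith [hbge v])
    nlinarith

open ArithmeticFunction in
lemma exists_continuousOn_LSeries_vonMangoldt :
    ∃ G : ℂ → ℂ, ContinuousOn G {s | 1 ≤ s.re} ∧
      ∀ s : ℂ, 1 < s.re → LSeries (fun n ↦ (vonMangoldt n : ℂ)) s = G s + 1 / (s - 1) := by
  refine ⟨vonMangoldt.LFunctionResidueClassAux (q := 1) 1,
    vonMangoldt.continuousOn_LFunctionResidueClassAux 1, fun s hs ↦ ?_⟩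
  have h := vonMangoldt.eqOn_LFunctionResidueClassAux (q := 1) (a := 1) isUnit_one hs
  have h1 : (fun n ↦ (vonMangoldt.residueClass (1 : ZMod 1) n : ℂ)) =
      fun n ↦ (vonMangoldt n : ℂ) := by
    ext n
    simp [vonMangoldt.residueClass, Set.indicator, Subsingleton.elim (n : ZMod 1) 1]
  simp only [h1] at h
  rw [h]
  simp

/-- The relative error `ψ(x) / x - 1` at `x = exp u`, for `u > 0`. -/
noncomputable def psiError : ℝ → ℝ :=
  (Ioi 0).indicator fun u ↦ Chebyshev.psi (Real.exp u) * Real.exp (-u) - 1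

lemma measurable_psiError : Measurable psiError := by
  refine Measurable.indicator ?_ measurableSet_Ioi
  have := Chebyshev.psi_mono.measurable
  fun_prop

lemma psiError_of_pos {u : ℝ} (hu : 0 < u) :
    psiError u = Chebyshev.psi (Real.exp u) * Real.exp (-u) - 1 := indicator_of_mem hu _

lemma psiError_of_nonpos {u : ℝ} (hu : u ≤ 0) : psiError u = 0 :=
  indicator_of_notMem (notMem_Ioi.mpr hu) _

lemma psi_exp_mul_exp_neg_le (u : ℝ) :
    Chebyshev.psi (Real.exp u) * Real.exp (-u) ≤ Real.log 4 + 4 := by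
  rw [Real.exp_neg, ← div_eq_mul_inv, div_le_iff₀ (Real.exp_pos u)]
  exact Chebyshev.psi_le_const_mul_self (Real.exp_pos u).le

lemma neg_one_le_psiError (u : ℝ) : -1 ≤ psiError u := by
  rcases le_or_gt u 0 with hu | hu
  · simp [psiError_of_nonpos hu]
  · rw [psiError_of_pos hu]
    have := mul_nonneg (Chebyshev.psi_nonneg (Real.exp u)) (Real.exp_pos (-u)).le
    linarith

lemma abs_psiError_le (u : ℝ) : |psiError u| ≤ Real.log 4 + 4 := by
  have h4 : 0 ≤ Real.log 4 := Real.log_nonneg (by norm_num)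
  refine abs_le.mpr ⟨by linarith [neg_one_le_psiError u], ?_⟩
  rcases le_or_gt u 0 with hu | hu
  · rw [psiError_of_nonpos hu]
    positivity
  · rw [psiError_of_pos hu]
    linarith [psi_exp_mul_exp_neg_le u]

lemma psiError_slowly_decreasing (u v : ℝ) (hu : 0 < u) (huv : u ≤ v) :
    (1 + psiError u) * Real.exp (u - v) ≤ 1 + psiError v := by
  rw [psiError_of_pos hu, psiError_of_pos (hu.trans_le huv), add_sub_cancel, add_sub_cancel,
    mul_assoc, ← Real.exp_add, show -u + (u - v) = -v by ring]
  gcongr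

open ArithmeticFunction in
lemma LSeries_vonMangoldt_eq_mul_integral_exp {s : ℂ} (hs : 1 < s.re) :
    LSeries (fun n ↦ (vonMangoldt n : ℂ)) s = s * ∫ u in Ioi (0 : ℝ),
      ((Chebyshev.psi (Real.exp u) * Real.exp (-u) : ℝ) : ℂ) * Complex.exp (-(s - 1) * u) := by
  have hpsi (t : ℝ) : ∑ k ∈ Finset.Icc 1 ⌊t⌋₊, vonMangoldt k = Chebyshev.psi t := rfl
  rw [LSeries_eq_mul_integral_of_nonneg vonMangoldt zero_le_one hs ?_
    fun _ ↦ vonMangoldt_nonneg]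
  · congr 1
    have himg : Real.exp '' Ioi 0 = Ioi 1 := by
      ext t
      simp only [mem_image, mem_Ioi]
      refine ⟨?_, fun ht ↦ ⟨Real.log t, Real.log_pos ht, Real.exp_log (by linarith)⟩⟩
      rintro ⟨u, hu, rfl⟩
      exact Real.one_lt_exp_iff.mpr hu
    rw [← himg, integral_image_eq_integral_abs_deriv_smul measurableSet_Ioi
      (fun u _ ↦ (Real.hasDerivAt_exp u).hasDerivWithinAt) Real.exp_injective.injOn]
    congr 1 with u
    rw [← Complex.ofReal_sum, hpsi, Real.abs_exp, Complex.real_smul,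
      Complex.cpow_def_of_ne_zero (by simp), ← Complex.ofReal_log (Real.exp_pos u).le,
      Real.log_exp]
    have : Complex.exp u * Complex.exp (u * -(s + 1)) =
        Complex.exp (-u) * Complex.exp (-(s - 1) * u) := by
      rw [← Complex.exp_add, ← Complex.exp_add]
      ring_nf
    push_cast
    linear_combination (Chebyshev.psi (Real.exp u) : ℂ) * this
  · refine Asymptotics.IsBigO.of_bound (Real.log 4 + 4) (Eventually.of_forall fun n ↦ ?_)
    have h := hpsi n
    rw [Nat.floor_natCast] at h
    rw [h, Real.rpow_one, Real.norm_of_nonneg (Chebyshev.psi_nonneg _),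
      Real.norm_of_nonneg n.cast_nonneg]
    exact Chebyshev.psi_le_const_mul_self n.cast_nonneg

lemma integral_psiError_mul_cexp {G : ℂ → ℂ} (hG : ∀ s : ℂ, 1 < s.re →
      LSeries (fun n ↦ (ArithmeticFunction.vonMangoldt n : ℂ)) s = G s + 1 / (s - 1))
    {z : ℂ} (hz : 0 < z.re) :
    ∫ u : ℝ, (psiError u : ℂ) * Complex.exp (-z * u) = (G (z + 1) - 1) / (z + 1) := by
  have hexp : IntegrableOn (fun u : ℝ ↦ Complex.exp (-z * u)) (Ioi 0) :=
    integrableOn_exp_mul_complex_Ioi (by simpa using hz) 0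
  have hpsi : IntegrableOn (fun u : ℝ ↦ ((Chebyshev.psi (Real.exp u) * Real.exp (-u) : ℝ) : ℂ) *
      Complex.exp (-z * u)) (Ioi 0) := by
    refine Integrable.bdd_mul (c := Real.log 4 + 4) hexp ?_ (Eventually.of_forall fun u ↦ ?_)
    · have := Chebyshev.psi_mono.measurable
      exact Measurable.aestronglyMeasurable (by fun_prop)
    · rw [Complex.norm_real, Real.norm_of_nonneg
        (mul_nonneg (Chebyshev.psi_nonneg _) (Real.exp_pos _).le)]
      exact psi_exp_mul_exp_neg_le u
  have hL := LSeries_vonMangoldt_eq_mul_integral_exp (s := z + 1) (by simpa using hz)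
  rw [hG (z + 1) (by simpa using hz), add_sub_cancel_right] at hL
  have hz0 : z ≠ 0 := by
    rintro rfl
    simp at hz
  have hz1 : z + 1 ≠ 0 := by
    intro h
    have := congrArg Complex.re h
    simp at this
    linarith
  have hsplit : ∫ u : ℝ, (psiError u : ℂ) * Complex.exp (-z * u) =
      (∫ u in Ioi (0 : ℝ), ((Chebyshev.psi (Real.exp u) * Real.exp (-u) : ℝ) : ℂ) *
        Complex.exp (-z * u)) - ∫ u in Ioi (0 : ℝ), Complex.exp (-z * u) := by
    rw [← integral_sub hpsi hexp, ← setIntegral_eq_integral_of_forall_compl_eq_zero (s := Ioi 0)]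
    · refine setIntegral_congr_fun measurableSet_Ioi fun u hu ↦ ?_
      simp only [psiError_of_pos hu]
      push_cast
      ring
    · intro u hu
      simp [psiError_of_nonpos (not_lt.mp hu)]
  rw [hsplit, integral_exp_mul_complex_Ioi (by simpa using hz), eq_div_iff hz1, sub_mul,
    mul_comm _ (z + 1), ← hL]
  simp
  field_simp
  ring

/-- The prime number theorem for the Chebyshev function `ψ`. -/
theorem tendsto_psi_div_self : Tendsto (fun x ↦ Chebyshev.psi x / x) atTop (𝓝 1) := by
  obtain ⟨G, hGc, hG⟩ := exists_continuousOn_LSeries_vonMangoldt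
  have hHc : ContinuousOn (fun z ↦ (G (z + 1) - 1) / (z + 1)) {z : ℂ | 0 ≤ z.re} := by
    refine ContinuousOn.div ((hGc.comp (by fun_prop) fun z hz ↦ ?_).sub continuousOn_const)
      (by fun_prop) fun z hz h ↦ ?_
    · simpa using hz
    · have h1 := congrArg Complex.re h
      have h2 : 0 ≤ z.re := hz
      simp at h1
      linarith
  have h := tendsto_zero_of_laplace_continuousOn measurable_psiError abs_psiError_le
    (fun _ ↦ psiError_of_nonpos) psiError_slowly_decreasing neg_one_le_psiError hHc
    fun z hz ↦ integral_psiError_mul_cexp hG hz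
  have h1 := (h.comp Real.tendsto_log_atTop).add_const 1
  rw [zero_add] at h1
  refine h1.congr' ?_
  filter_upwards [eventually_gt_atTop 1] with x hx
  simp [psiError_of_pos (Real.log_pos hx), Real.exp_neg, Real.exp_log (zero_lt_one.trans hx),
    div_eq_mul_inv]

/-- The prime number theorem for the Chebyshev function `θ`. -/
theorem tendsto_theta_div_self : Tendsto (fun x ↦ Chebyshev.theta x / x) atTop (𝓝 1) := by
  have h1 : Tendsto (fun x ↦ (Chebyshev.psi x - Chebyshev.theta x) / x) atTop (𝓝 0) := by
    have h2 : (fun x ↦ Chebyshev.psi x - Chebyshev.theta x) =o[atTop] fun x ↦ x := by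
      refine Chebyshev.isBigO_psi_sub_theta_sqrt.trans_isLittleO ?_
      refine Asymptotics.isLittleO_of_tendsto (fun x hx ↦ by simp [hx]) ?_
      simp_rw [Real.sqrt_div_self]
      exact (tendsto_inv_atTop_zero.comp Real.tendsto_sqrt_atTop).congr fun x ↦ by simp
    exact h2.tendsto_div_nhds_zero
  have h := tendsto_psi_div_self.sub h1
  rw [sub_zero] at h
  refine h.congr fun x ↦ ?_
  ring

/-- Primes in `(x / 2, x]` weighted by their logarithms are at most their number times `log x`. -/
lemma theta_sub_theta_half_le (x : ℕ) :
    Chebyshev.theta x - Chebyshev.theta (x / 2 : ℕ) ≤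
      (x.primeCounting - (x / 2).primeCounting : ℕ) * Real.log x := by
  have hsub : Nat.primesLE (x / 2) ⊆ Nat.primesLE x := by
    intro p hp
    simp only [Nat.mem_primesLE] at hp ⊢
    exact ⟨hp.1.trans (Nat.div_le_self x 2), hp.2⟩
  rw [Chebyshev.theta_eq_sum_primesLE_log, Chebyshev.theta_eq_sum_primesLE_log,
    ← Finset.sum_sdiff_eq_sub hsub, ← Nat.primesLE_card_eq_primeCounting,
    ← Nat.primesLE_card_eq_primeCounting, ← Finset.card_sdiff_of_subset hsub, ← nsmul_eq_mul]
  refine Finset.sum_le_card_nsmul _ _ _ fun p hp ↦ ?_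
  have hp' := Nat.mem_primesLE.mp (Finset.mem_sdiff.mp hp).1
  exact Real.log_le_log (by exact_mod_cast hp'.2.pos) (by exact_mod_cast hp'.1)

lemma eventually_le_primeCounting_sub {c : ℝ} (hc : c < 1 / 2) :
    ∀ᶠ x : ℕ in atTop,
      c * x ≤ (x.primeCounting - (x / 2).primeCounting : ℕ) * Real.log x := by
  have hθ : Tendsto (fun x : ℕ ↦ Chebyshev.theta x / x) atTop (𝓝 1) :=
    tendsto_theta_div_self.comp tendsto_natCast_atTop_atTop
  set d := (1 / 2 - c) / 2 with hd
  have hd0 : 0 < d := by rw [hd]; linarith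
  have hhalf : Tendsto (fun x : ℕ ↦ x / 2) atTop atTop := Nat.tendsto_div_const_atTop two_ne_zero
  filter_upwards [hθ.eventually (lt_mem_nhds (show 1 - d < 1 by linarith)),
    (hθ.comp hhalf).eventually (gt_mem_nhds (show 1 < 1 + d by linarith)),
    eventually_ge_atTop 2] with x h1 h2 hx
  refine le_trans ?_ (theta_sub_theta_half_le x)
  have hx0 : (0 : ℝ) < x := by positivity
  have hx2 : (0 : ℝ) < (x / 2 : ℕ) := by exact_mod_cast Nat.div_pos hx two_pos
  have hle : ((x / 2 : ℕ) : ℝ) ≤ x / 2 := Nat.cast_div_le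
  rw [lt_div_iff₀ hx0] at h1
  simp only [Function.comp_def] at h2
  rw [div_lt_iff₀ hx2] at h2
  have h3 := mul_le_mul_of_nonneg_left hle (show 0 ≤ 1 + d by linarith)
  have h4 : c = 1 / 2 - 2 * d := by rw [hd]; ring
  rw [h4]
  nlinarith

theorem ramanujan_upper_asymptotic (ε : ℝ) (hε : 0 < ε) :
    ∃ n₀ : ℕ, 0 < n₀ ∧ ∀ n : ℕ, n₀ ≤ n →
      (ramanujan n : ℝ) < (2 + ε) * n * Real.log n := by
  set c : ℝ := 1 / (2 + ε / 4) with hc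
  have hc2 : c < 1 / 2 := one_div_lt_one_div_of_lt two_pos (by linarith)
  set δ : ℝ := c * (2 + ε / 2) - 1 with hδ
  have hδ0 : 0 < δ := by
    rw [hδ, hc, one_div, inv_mul_eq_div, sub_pos, one_lt_div (by positivity)]
    linarith
  obtain ⟨X, hX⟩ := eventually_atTop.mp (eventually_le_primeCounting_sub hc2)
  have hlog : Tendsto (fun n : ℕ ↦ Real.log n) atTop atTop :=
    Real.tendsto_log_atTop.comp tendsto_natCast_atTop_atTop
  have hnlog : Tendsto (fun n : ℕ ↦ n * Real.log n) atTop atTop :=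
    (tendsto_natCast_atTop_atTop (R := ℝ)).atTop_mul_atTop₀ hlog
  have hlogpow : ∀ᶠ n : ℕ in atTop, (2 + ε / 2) * Real.log n ≤ (n : ℝ) ^ δ := by
    have h := ((isLittleO_log_rpow_atTop hδ0).comp_tendsto
      (tendsto_natCast_atTop_atTop (R := ℝ))).bound (show 0 < (2 + ε / 2)⁻¹ by positivity)
    filter_upwards [h, eventually_ge_atTop 1] with n hn hn1
    have h1 : 0 ≤ Real.log n := Real.log_natCast_nonneg n
    simp only [Function.comp_def] at hn
    rwa [Real.norm_of_nonneg h1, Real.norm_of_nonneg (by positivity), inv_mul_eq_div,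
      le_div_iff₀ (by positivity), mul_comm] at hn
  have hev : ∀ᶠ n : ℕ in atTop, (ramanujan n : ℝ) < (2 + ε) * n * Real.log n := by
    filter_upwards [hlogpow, eventually_gt_atTop 1,
      hnlog.eventually_ge_atTop (max (X : ℝ) (max (Real.exp 1) (2 / ε)))] with n hpow hn1 hbig
    obtain ⟨hbX, hbe, hbε⟩ : (X : ℝ) ≤ n * Real.log n ∧ Real.exp 1 ≤ n * Real.log n ∧
        2 / ε ≤ n * Real.log n := by simpa using hbig
    have hn0 : (0 : ℝ) < n := by positivity
    have hL : 0 < Real.log n := Real.log_pos (by exact_mod_cast hn1)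
    set y : ℝ := (2 + ε / 2) * (n * Real.log n) with hy
    have hy0 : 0 < y := by positivity
    have hle : n * Real.log n ≤ y := by
      have : 0 < n * Real.log n := by positivity
      rw [hy]
      nlinarith
    have hlogy : Real.log y ≤ (1 + δ) * Real.log n := by
      rw [← Real.log_rpow hn0]
      refine Real.log_le_log hy0 ?_
      rw [Real.rpow_add hn0, Real.rpow_one, hy]
      nlinarith
    have hR : ramanujan n ≤ ⌈y⌉₊ := by
      refine Nat.sInf_le ⟨Nat.ceil_pos.mpr hy0, fun x hx ↦ ?_⟩
      have hyx : y ≤ x := Nat.ceil_le.mp hx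
      have hx0 : (0 : ℝ) < x := hy0.trans_le hyx
      have hxe : Real.exp 1 ≤ x := (hbe.trans hle).trans hyx
      have hlogx : 0 < Real.log x :=
        Real.log_pos ((Real.one_lt_exp_iff.mpr one_pos).trans_le hxe)
      have h1 := hX x (by exact_mod_cast (hbX.trans hle).trans hyx)
      have h2 : Real.log x / x ≤ Real.log y / y :=
        Real.log_div_self_antitoneOn (hbe.trans hle) hxe hyx
      have h3 : Real.log y / y ≤ c / n := by
        rw [div_le_div_iff₀ hy0 hn0]
        calc Real.log y * n ≤ (1 + δ) * Real.log n * n := by gcongr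
          _ = c * y := by rw [hy, hδ]; ring
      have h4 := h2.trans h3
      rw [div_le_div_iff₀ hx0 hn0] at h4
      have h5 : (n : ℝ) * Real.log x ≤
          (x.primeCounting - (x / 2).primeCounting : ℕ) * Real.log x := by linarith
      exact_mod_cast le_of_mul_le_mul_right h5 hlogx
    calc (ramanujan n : ℝ) ≤ ⌈y⌉₊ := by exact_mod_cast hR
      _ < y + 1 := Nat.ceil_lt_add_one hy0.le
      _ ≤ (2 + ε) * n * Real.log n := by
        rw [div_le_iff₀ hε] at hbε
        rw [hy]
        linarith
  obtain ⟨N, hN⟩ := eventually_atTop.mp hev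
  exact ⟨N + 1, N.succ_pos, fun n hn ↦ hN n (by omega)⟩
end
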